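/- Let K ⊂ S² be a convex body of width w with 0 < w ≤ π/2 and let T_w ⊂ S² be a regular spherical triangle of width w. Then r(T_w) ≤ r(K), and equality holds if and only if K is congruent to T_w. -/

import Mathlib

open scoped RealInnerProductSpace
open Real MeasureTheory

noncomputable section

namespace SphericalPal

/-- Ambient Euclidean space of the sphere `Sⁿ`. -/
abbrev E (n : ℕ) := EuclideanSpace ℝ (Fin (n + 1))

/-- The unit sphere `Sⁿ ⊂ ℝⁿ⁺¹`. -/
def unitSphere (n : ℕ) : Set (E n) := Metric.sphere 0 1

variable {n : ℕ}

/-- Geodesic (angular) distance on the unit sphere. -/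
def gdist (x y : E n) : ℝ := Real.arccos ⟪x, y⟫

/-- The geodesic segment joining `x` and `y` on the sphere. -/
def seg (x y : E n) : Set (E n) :=
  {z ∈ unitSphere n | gdist x z + gdist z y = gdist x y}

/-- A subset of the sphere is spherically convex if it lies on the sphere, is contained
in an open hemisphere and contains the geodesic segment joining any two of its points. -/
def SConvex (X : Set (E n)) : Prop :=
  X ⊆ unitSphere n ∧
  (∃ u ∈ unitSphere n, ∀ x ∈ X, 0 < ⟪u, x⟫) ∧
  ∀ x ∈ X, ∀ y ∈ X, seg x y ⊆ X

/-- Spherical convex hull. -/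
def sconv (X : Set (E n)) : Set (E n) := ⋂₀ {C | SConvex C ∧ X ⊆ C}

/-- Relative (spherical) interior of a subset of the sphere. -/
def sInterior (X : Set (E n)) : Set (E n) :=
  {x ∈ X | ∃ ε > 0, ∀ y ∈ unitSphere n, gdist x y < ε → y ∈ X}

/-- A spherical convex body: compact, spherically convex, with nonempty relative interior. -/
def IsConvexBody (K : Set (E n)) : Prop :=
  SConvex K ∧ IsCompact K ∧ (sInterior K).Nonempty

/-- The lune determined by `u` and `v` (intersection of the closed hemispheres
opposite to `u` and to `v`). -/
def lune (u v : E n) : Set (E n) := {x ∈ unitSphere n | ⟪x, u⟫ ≤ 0 ∧ ⟪x, v⟫ ≤ 0}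

/-- The bounding hemisphere of `lune u v` contained in the great sphere orthogonal to `u`. -/
def luneFace (u v : E n) : Set (E n) := {x ∈ unitSphere n | ⟪x, u⟫ = 0 ∧ ⟪x, v⟫ ≤ 0}

/-- The center (midpoint) of the bounding hemisphere `luneFace u v`. -/
def luneFaceCenter (u v : E n) : E n :=
  ‖(⟪u, v⟫ • u - v : E n)‖⁻¹ • (⟪u, v⟫ • u - v)

/-- The breadth of the lune `lune u v`: the geodesic distance of the centers of the
two bounding hemispheres. -/
def breadth (u v : E n) : ℝ := gdist (luneFaceCenter u v) (luneFaceCenter v u)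

/-- `lune u v` is a supporting lune of `K`. -/
def IsSupportingLune (K : Set (E n)) (u v : E n) : Prop :=
  u ∈ unitSphere n ∧ v ∈ unitSphere n ∧ u ≠ v ∧ u ≠ -v ∧
  K ⊆ lune u v ∧ (K ∩ luneFace u v).Nonempty ∧ (K ∩ luneFace v u).Nonempty

/-- The (minimal) width of a spherical convex body. -/
def width (K : Set (E n)) : ℝ :=
  sInf {b | ∃ u v : E n, IsSupportingLune K u v ∧ b = breadth u v}

/-- The width of `K` with respect to the supporting great hypersphere orthogonal to `u`:
the minimal breadth among supporting lunes of `K` having one bounding hemisphere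
contained in that great hypersphere. -/
def widthAt (K : Set (E n)) (u : E n) : ℝ :=
  sInf {b | ∃ v : E n, IsSupportingLune K u v ∧ b = breadth u v}

/-- The great hypersphere orthogonal to `u` supports `K`. -/
def IsSupportingSphere (K : Set (E n)) (u : E n) : Prop :=
  u ∈ unitSphere n ∧ (∀ x ∈ K, ⟪x, u⟫ ≤ 0) ∧ ∃ x ∈ K, ⟪x, u⟫ = 0

/-- `K` is of constant width `w`. -/
def HasConstantWidth (K : Set (E n)) (w : ℝ) : Prop :=
  ∀ u : E n, IsSupportingSphere K u → widthAt K u = w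

/-- `K` is a reduced convex body. -/
def IsReduced (K : Set (E n)) : Prop :=
  IsConvexBody K ∧ ∀ L : Set (E n), IsConvexBody L → L ⊆ K → L ≠ K → width L < width K

/-- The spherical polar set. -/
def polar (A : Set (E n)) : Set (E n) := {u ∈ unitSphere n | ∀ a ∈ A, ⟪a, u⟫ ≤ 0}

/-- Closed geodesic ball on the sphere. -/
def gball (p : E n) (r : ℝ) : Set (E n) := {x ∈ unitSphere n | gdist p x ≤ r}

/-- The inradius of `K`: the largest `r` such that some geodesic ball of radius `r`
is contained in `K`. -/
def inradius (K : Set (E n)) : ℝ :=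
  sSup {r | 0 ≤ r ∧ ∃ p ∈ unitSphere n, gball p r ⊆ K}

/-- Geodesic distance from a point to a set. -/
def sdist (x : E n) (A : Set (E n)) : ℝ := sInf (gdist x '' A)

/-- Hausdorff distance with respect to the geodesic metric. -/
def hausdorffG (A B : Set (E n)) : ℝ :=
  max (sSup ((fun x => sdist x B) '' A)) (sSup ((fun y => sdist y A) '' B))

/-- Two subsets of the sphere are congruent, i.e., isometric by an orthogonal
transformation of the ambient Euclidean space. -/
def Congruent (A B : Set (E n)) : Prop :=
  ∃ f : E n ≃ₗᵢ[ℝ] E n, f '' A = B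

/-- Spherical surface measure on `S²` (2-dimensional Hausdorff measure). -/
def area (X : Set (E 2)) : ℝ := (μH[2] X).toReal

/-- The spherical angle `∠(x, p, y)` at `p` between the geodesic segments `[p,x]`, `[p,y]`. -/
def sangle (x p y : E 2) : ℝ :=
  InnerProductGeometry.angle (x - ⟪p, x⟫ • p) (y - ⟪p, y⟫ • p)

/-- `T` is a regular spherical triangle: the spherical convex hull of three points
with equal pairwise geodesic distances, not lying on a common great circle. -/
def IsRegularTriangle (T : Set (E 2)) : Prop :=
  ∃ v₁ v₂ v₃ : E 2, v₁ ∈ unitSphere 2 ∧ v₂ ∈ unitSphere 2 ∧ v₃ ∈ unitSphere 2 ∧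
    LinearIndependent ℝ ![v₁, v₂, v₃] ∧
    gdist v₁ v₂ = gdist v₂ v₃ ∧ gdist v₂ v₃ = gdist v₁ v₃ ∧
    T = sconv {v₁, v₂, v₃}

/-- Three points on the sphere with equal pairwise geodesic distance `a`
(the vertices of a regular spherical triangle of side length `a`). -/
def IsRegularCenters (x₁ x₂ x₃ : E 2) (a : ℝ) : Prop :=
  x₁ ∈ unitSphere 2 ∧ x₂ ∈ unitSphere 2 ∧ x₃ ∈ unitSphere 2 ∧
  gdist x₁ x₂ = a ∧ gdist x₂ x₃ = a ∧ gdist x₁ x₃ = a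

/-- `U` is a spherical Reuleaux triangle: intersection of three geodesic balls of radius `r`
whose centers have pairwise geodesic distance `r`. -/
def IsReuleaux (U : Set (E 2)) (r : ℝ) : Prop :=
  ∃ x₁ x₂ x₃ : E 2, IsRegularCenters x₁ x₂ x₃ r ∧
    U = gball x₁ r ∩ gball x₂ r ∩ gball x₃ r

/-- The body `U°_{π-w}` for `w > π/2`: the spherical convex hull of three geodesic balls
of radius `w - π/2` (whose centers are meant to form a regular triangle of side `π - w`). -/
def polarReuleaux (x₁ x₂ x₃ : E 2) (w : ℝ) : Set (E 2) :=
  sconv (gball x₁ (w - π / 2) ∪ gball x₂ (w - π / 2) ∪ gball x₃ (w - π / 2))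

end SphericalPal

open SphericalPal

namespace SphericalPal

lemma mem_us {n : ℕ} {x : E n} : x ∈ unitSphere n ↔ ‖x‖ = 1 := by
  simp [unitSphere]

lemma inner_self_us {n : ℕ} {x : E n} (hx : ‖x‖ = 1) : ⟪x, x⟫ = 1 := by
  rw [real_inner_self_eq_norm_sq, hx]; norm_num

lemma inner_le_one_us {n : ℕ} {x y : E n} (hx : ‖x‖ = 1) (hy : ‖y‖ = 1) : ⟪x, y⟫ ≤ 1 := by
  have := real_inner_le_norm x y
  rw [hx, hy] at this; linarith

lemma neg_one_le_inner_us {n : ℕ} {x y : E n} (hx : ‖x‖ = 1) (hy : ‖y‖ = 1) :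
    -1 ≤ ⟪x, y⟫ := by
  have := abs_real_inner_le_norm x y
  rw [hx, hy] at this
  have := (abs_le.1 this).1
  linarith

lemma eq_of_inner_one_us {n : ℕ} {x y : E n} (hx : ‖x‖ = 1) (hy : ‖y‖ = 1)
    (h : ⟪x, y⟫ = 1) : x = y := (inner_eq_one_iff_of_norm_eq_one hx hy).1 h

lemma gdist_eq_angle {n : ℕ} {x y : E n} (hx : ‖x‖ = 1) (hy : ‖y‖ = 1) :
    gdist x y = InnerProductGeometry.angle x y := by
  simp [gdist, InnerProductGeometry.angle, hx, hy]

lemma norm_normalize {n : ℕ} {z : E n} (hz : z ≠ 0) : ‖(‖z‖⁻¹ • z : E n)‖ = 1 := by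
  rw [norm_smul, norm_inv, norm_norm, inv_mul_cancel₀ (norm_ne_zero_iff.2 hz)]

lemma seg_mem_of_comb {n : ℕ} {x y : E n} (hx : ‖x‖ = 1) (hy : ‖y‖ = 1) {a b : ℝ}
    (ha : 0 ≤ a) (hb : 0 ≤ b) (hz : a • x + b • y ≠ 0) :
    ‖a • x + b • y‖⁻¹ • (a • x + b • y) ∈ seg x y := by
  have h1 := norm_normalize hz
  refine ⟨mem_us.2 h1, ?_⟩
  have hp : 0 < ‖a • x + b • y‖⁻¹ := inv_pos.2 (norm_pos_iff.2 hz)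
  rw [gdist_eq_angle hx h1, gdist_eq_angle h1 hy, gdist_eq_angle hx hy,
    InnerProductGeometry.angle_smul_right_of_pos _ _ hp,
    InnerProductGeometry.angle_smul_left_of_pos _ _ hp]
  symm
  apply InnerProductGeometry.angle_eq_angle_add_add_angle_add_of_mem_span hz
  rw [Submodule.mem_span_pair]
  exact ⟨⟨a, ha⟩, ⟨b, hb⟩, rfl⟩

lemma comb_of_seg {n : ℕ} {x y z h : E n} (hx : ‖x‖ = 1) (hy : ‖y‖ = 1)
    (hhx : 0 < ⟪h, x⟫) (hhy : 0 < ⟪h, y⟫) (hz : z ∈ seg x y) :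
    ∃ a b : ℝ, 0 ≤ a ∧ 0 ≤ b ∧ z = a • x + b • y := by
  obtain ⟨hz1, hz2⟩ := hz
  rw [mem_us] at hz1
  have hz0 : z ≠ 0 := by
    intro h0; simp [h0] at hz1
  rw [gdist_eq_angle hx hz1, gdist_eq_angle hz1 hy, gdist_eq_angle hx hy] at hz2
  rcases (InnerProductGeometry.angle_eq_angle_add_angle_iff hz0).1 hz2.symm with h1 | h1
  · exfalso
    obtain ⟨-, r, hr, rfl⟩ := InnerProductGeometry.angle_eq_pi_iff.1 h1
    rw [inner_smul_right] at hhy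
    nlinarith
  · rw [Submodule.mem_span_pair] at h1
    obtain ⟨a, b, rfl⟩ := h1
    exact ⟨a, b, a.2, b.2, rfl⟩

lemma norm_sq_face {n : ℕ} {u v : E n} (hu : ‖u‖ = 1) (hv : ‖v‖ = 1) :
    ‖(⟪u, v⟫ • u - v : E n)‖ ^ 2 = 1 - ⟪u, v⟫ ^ 2 := by
  rw [norm_sub_sq_real, norm_smul, hu, hv, real_inner_smul_left, Real.norm_eq_abs, mul_one,
    sq_abs]
  ring

lemma inner_sq_lt_one {n : ℕ} {u v : E n} (hu : ‖u‖ = 1) (hv : ‖v‖ = 1) (h1 : u ≠ v)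
    (h2 : u ≠ -v) : ⟪u, v⟫ ^ 2 < 1 := by
  have a1 : ⟪u, v⟫ < 1 := lt_of_le_of_ne (inner_le_one_us hu hv)
    (fun h => h1 (eq_of_inner_one_us hu hv h))
  have a2 : -1 < ⟪u, v⟫ := by
    apply lt_of_le_of_ne (neg_one_le_inner_us hu hv)
    intro h
    apply h2
    apply eq_of_inner_one_us hu (by simpa using hv)
    rw [inner_neg_right, ← h]; norm_num
  nlinarith

lemma breadth_eq {n : ℕ} {u v : E n} (hu : ‖u‖ = 1) (hv : ‖v‖ = 1) (h1 : u ≠ v)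
    (h2 : u ≠ -v) : breadth u v = Real.arccos (-⟪u, v⟫) := by
  have hlt := inner_sq_lt_one hu hv h1 h2
  have e1 := norm_sq_face hu hv
  have e2 := norm_sq_face hv hu
  rw [real_inner_comm] at e2
  have e3 : ‖(⟪u, v⟫ • u - v : E n)‖ = ‖(⟪u, v⟫ • v - u : E n)‖ := by
    rw [← sq_eq_sq₀ (norm_nonneg _) (norm_nonneg _), e1, e2]
  unfold breadth gdist luneFaceCenter
  rw [real_inner_comm u v, e3, real_inner_smul_left, real_inner_smul_right, ← mul_assoc,
    ← mul_inv, ← sq, e2]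
  congr 1
  have : ⟪(⟪u, v⟫ • u - v : E n), (⟪u, v⟫ • v - u : E n)⟫ = (1 - ⟪u, v⟫ ^ 2) * (-⟪u, v⟫) := by
    simp only [inner_sub_left, inner_sub_right, real_inner_smul_left, real_inner_smul_right,
      inner_self_us hu, inner_self_us hv, real_inner_comm u v]
    ring
  rw [this, ← mul_assoc, inv_mul_cancel₀ (by linarith), one_mul]

/-- monotonicity of `x / sqrt (x^2 + c)` in a division free form. -/
lemma ratio_lt {x y c : ℝ} (hc : 0 < c) (h : x < y) :
    x / √(x ^ 2 + c) < y / √(y ^ 2 + c) := by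
  have hx : 0 < x ^ 2 + c := by positivity
  have hy : 0 < y ^ 2 + c := by positivity
  have sx := Real.sqrt_pos.2 hx
  have sy := Real.sqrt_pos.2 hy
  rw [div_lt_div_iff₀ sx sy]
  have qx := Real.sq_sqrt hx.le
  have qy := Real.sq_sqrt hy.le
  set A := √(x ^ 2 + c)
  set B := √(y ^ 2 + c)
  rcases le_or_gt 0 x with h0 | h0
  · have hy0 : 0 ≤ y := by linarith
    apply lt_of_pow_lt_pow_left₀ 2 (by positivity)
    rw [mul_pow, mul_pow, qx, qy]
    nlinarith [mul_pos hc (sub_pos.2 h), mul_nonneg hc.le h0]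
  · rcases le_or_gt y 0 with h1 | h1
    · have : (-y) * A < (-x) * B := by
        apply lt_of_pow_lt_pow_left₀ 2 (by nlinarith)
        rw [mul_pow, mul_pow, qx, qy]
        nlinarith [mul_pos hc (sub_pos.2 h)]
      linarith
    · nlinarith [mul_pos h1 sx, mul_pos (neg_pos.2 h0) sy]

/-- The polar is compact. -/
lemma polar_compact {n : ℕ} (K : Set (E n)) : IsCompact (polar K) := by
  have : polar K = unitSphere n ∩ ⋂ a ∈ K, {u | ⟪a, u⟫ ≤ 0} := by
    ext u; simp [polar]
  rw [this]
  apply (isCompact_sphere _ _).inter_right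
  refine isClosed_biInter fun a _ => ?_
  exact isClosed_le (by fun_prop) continuous_const

lemma polar_of_cone {n : ℕ} {K : Set (E n)} {u : E n} (h0 : u ≠ 0) (h : ∀ a ∈ K, ⟪a, u⟫ ≤ 0) :
    ‖u‖⁻¹ • u ∈ polar K := by
  refine ⟨mem_us.2 (norm_normalize h0), fun a ha => ?_⟩
  rw [real_inner_smul_right]
  exact mul_nonpos_of_nonneg_of_nonpos (by positivity) (h a ha)

lemma exists_interior_neg {n : ℕ} {K : Set (E n)} (hK : IsConvexBody K) :
    ∃ x ∈ K, ∀ u ∈ polar K, ⟪x, u⟫ < 0 := by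
  obtain ⟨⟨hKs, -, -⟩, -, x, hx, ε, hε, hball⟩ := hK
  refine ⟨x, hx, fun u hu => lt_of_le_of_ne (hu.2 x hx) fun h0 => ?_⟩
  have nx := mem_us.1 (hKs hx)
  have nu := mem_us.1 hu.1
  set t := min (ε / 2) 1 with ht
  have t0 : 0 < t := by positivity
  have t1 : t ≤ 1 := min_le_right _ _
  have tpi : t < π := by linarith [Real.pi_gt_three]
  have ny : ‖(Real.cos t • x + Real.sin t • u : E n)‖ = 1 := by
    rw [← sq_eq_sq₀ (norm_nonneg _) zero_le_one, norm_add_sq_real, norm_smul, norm_smul, nx, nu,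
      real_inner_smul_left, real_inner_smul_right, h0]
    simp
  have := hball _ (mem_us.2 ny) (by
    unfold gdist
    rw [inner_add_right, real_inner_smul_right, real_inner_smul_right, h0, inner_self_us nx]
    simp only [mul_one, mul_zero, add_zero]
    rw [Real.arccos_cos t0.le tpi.le]
    have : t ≤ ε / 2 := min_le_left _ _
    linarith)
  have h2 := hu.2 _ this
  rw [inner_add_left, real_inner_smul_left, real_inner_smul_left, h0, inner_self_us nu] at h2
  have := Real.sin_pos_of_pos_of_lt_pi t0 tpi
  linarith

lemma exists_margin {n : ℕ} {K : Set (E n)} (hc : IsCompact K) {u : E n}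
    (h : ∀ x ∈ K, ⟪x, u⟫ < 0) : ∃ δ > 0, ∀ x ∈ K, ⟪x, u⟫ ≤ -δ := by
  rcases K.eq_empty_or_nonempty with rfl | hne
  · exact ⟨1, one_pos, by simp⟩
  obtain ⟨x, hx, hmax⟩ := hc.exists_isMaxOn hne
    (f := fun x => ⟪x, u⟫) (by fun_prop)
  exact ⟨-⟪x, u⟫, by linarith [h x hx], fun y hy => by simpa using hmax hy⟩

/-- If one of a pair of polar points with minimal inner product is not supporting we can move it. -/
lemma supporting_of_min {n : ℕ} {K : Set (E n)} (hKs : K ⊆ unitSphere n) (hc : IsCompact K)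
    {u v : E n} (hu : u ∈ polar K)
    (hv : v ∈ polar K) (h1 : u ≠ v) (h2 : u ≠ -v)
    (hmin : ∀ u' ∈ polar K, ⟪u, v⟫ ≤ ⟪u', v⟫) : ∃ x ∈ K, ⟪x, u⟫ = 0 := by
  by_contra! hcon
  have nu := mem_us.1 hu.1
  have nv := mem_us.1 hv.1
  obtain ⟨δ, hδ, hm⟩ := exists_margin hc (u := u)
    (fun x hx => lt_of_le_of_ne (hu.2 x hx) (hcon x hx))
  have hsq := inner_sq_lt_one nu nv h1 h2
  have hcone : ∀ x ∈ K, ⟪x, u - δ • v⟫ ≤ 0 := by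
    intro x hx
    rw [inner_sub_right, real_inner_smul_right]
    have := neg_one_le_inner_us (mem_us.1 (hKs hx)) nv
    nlinarith [hm x hx]
  have hne : u - δ • v ≠ 0 := by
    intro h0
    have hh : u = δ • v := sub_eq_zero.1 h0
    rw [hh, norm_smul, nv, mul_one, Real.norm_eq_abs, abs_of_pos hδ] at nu
    apply h1; rw [hh, nu, one_smul]
  have := hmin _ (polar_of_cone hne hcone)
  have hnp := norm_pos_iff.2 hne
  rw [real_inner_smul_left, inner_sub_left, real_inner_smul_left, inner_self_us nv,
    inv_mul_eq_div, le_div_iff₀ hnp] at this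
  have hN : ‖u - δ • v‖ ^ 2 = (⟪u, v⟫ - δ) ^ 2 + (1 - ⟪u, v⟫ ^ 2) := by
    rw [norm_sub_sq_real, norm_smul, nu, nv, real_inner_smul_right, Real.norm_eq_abs,
      abs_of_pos hδ]
    ring
  have hr := ratio_lt (x := ⟪u, v⟫ - δ) (y := ⟪u, v⟫) (c := 1 - ⟪u, v⟫ ^ 2) (by linarith)
    (by linarith)
  rw [← hN, Real.sqrt_sq hnp.le, show ⟪u, v⟫ ^ 2 + (1 - ⟪u, v⟫ ^ 2) = 1 by ring, Real.sqrt_one,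
    div_one, div_lt_iff₀ hnp] at hr
  linarith

lemma width_le {n : ℕ} {K : Set (E n)} (hK : IsConvexBody K) {u v : E n} (hu : u ∈ polar K)
    (hv : v ∈ polar K) (h1 : u ≠ v) : width K ≤ Real.arccos (-⟪u, v⟫) := by
  obtain ⟨⟨p, q⟩, ⟨hp, hq⟩, hmin⟩ := ((polar_compact K).prod (polar_compact K)).exists_isMinOn
    ⟨(u, v), hu, hv⟩ (f := fun z : E n × E n => ⟪z.1, z.2⟫) (by fun_prop)
  simp only at hp hq
  have hmin' : ∀ a ∈ polar K, ∀ b ∈ polar K, ⟪p, q⟫ ≤ ⟪a, b⟫ := fun a ha b hb => by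
    have := hmin (show (a, b) ∈ polar K ×ˢ polar K from ⟨ha, hb⟩)
    simpa using this
  have np := mem_us.1 hp.1
  have nq := mem_us.1 hq.1
  have hpq1 : p ≠ q := by
    rintro rfl
    have := hmin' u hu v hv
    rw [inner_self_us np] at this
    exact h1 (eq_of_inner_one_us (mem_us.1 hu.1) (mem_us.1 hv.1)
      (le_antisymm (inner_le_one_us (mem_us.1 hu.1) (mem_us.1 hv.1)) this))
  have hpq2 : p ≠ -q := by
    rintro rfl
    obtain ⟨x, hx, hneg⟩ := exists_interior_neg hK
    have a1 := hneg _ hp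
    have a2 := hneg _ hq
    rw [inner_neg_right] at a1
    linarith
  have hKs := hK.1.1
  have hc := hK.2.1
  have s1 := supporting_of_min hKs hc hp hq hpq1 hpq2 (fun a ha => hmin' a ha q hq)
  have s2 := supporting_of_min hKs hc hq hp hpq1.symm
    (fun h => hpq2 (by rw [h, neg_neg])) (fun a ha => by
      rw [real_inner_comm, real_inner_comm p a]; exact hmin' p hp a ha)
  have hsup : IsSupportingLune K p q := by
    refine ⟨hp.1, hq.1, hpq1, hpq2, fun x hx => ⟨hKs hx, hp.2 x hx, hq.2 x hx⟩, ?_, ?_⟩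
    · obtain ⟨x, hx, h0⟩ := s1
      exact ⟨x, hx, hKs hx, h0, hq.2 x hx⟩
    · obtain ⟨x, hx, h0⟩ := s2
      exact ⟨x, hx, hKs hx, h0, hp.2 x hx⟩
  calc width K ≤ breadth p q := by
        apply csInf_le
        · refine ⟨0, ?_⟩
          rintro b ⟨u, v, -, rfl⟩
          exact Real.arccos_nonneg _
        · exact ⟨p, q, hsup, rfl⟩
    _ = Real.arccos (-⟪p, q⟫) := breadth_eq np nq hpq1 hpq2
    _ ≤ _ := Real.arccos_le_arccos (by linarith [hmin' u hu v hv])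

end SphericalPal
namespace SphericalPal

lemma bipolar {n : ℕ} {K : Set (E n)} (hK : IsConvexBody K) {x : E n} (hx : ‖x‖ = 1)
    (h : ∀ u ∈ polar K, ⟪x, u⟫ ≤ 0) : x ∈ K := by
  obtain ⟨k₀, hk₀, -⟩ := exists_interior_neg hK
  obtain ⟨⟨hKs, ⟨c, -, hhem⟩, hseg⟩, hcomp, -⟩ := hK
  by_contra hxK
  let C : Set (E n) := {y | ∃ t : ℝ, 0 ≤ t ∧ ∃ k ∈ K, y = t • k}
  have hconv : Convex ℝ C := by
    rintro _ ⟨t₁, ht₁, k₁, hk₁, rfl⟩ _ ⟨t₂, ht₂, k₂, hk₂, rfl⟩ a b ha hb -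
    rw [smul_smul, smul_smul]
    by_cases hz : (a * t₁) • k₁ + (b * t₂) • k₂ = 0
    · rw [hz]; exact ⟨0, le_rfl, k₁, hk₁, by simp⟩
    · refine ⟨‖(a * t₁) • k₁ + (b * t₂) • k₂‖, norm_nonneg _, _, hseg k₁ hk₁ k₂ hk₂
        (seg_mem_of_comb (mem_us.1 (hKs hk₁)) (mem_us.1 (hKs hk₂)) (mul_nonneg ha ht₁)
          (mul_nonneg hb ht₂) hz), ?_⟩
      rw [smul_smul, mul_inv_cancel₀ (norm_ne_zero_iff.2 hz), one_smul]
  have hclosed : IsClosed C := by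
    rw [← closure_subset_iff_isClosed]
    intro y hy
    by_cases hy0 : y = 0
    · exact ⟨0, le_rfl, k₀, hk₀, by simp [hy0]⟩
    have hcont : ContinuousAt (fun z : E n => ‖z‖⁻¹ • z) y := by
      have h1 : ContinuousAt (fun z : E n => ‖z‖⁻¹) y :=
        ContinuousAt.inv₀ continuous_norm.continuousAt (norm_ne_zero_iff.2 hy0)
      exact h1.smul continuousAt_id
    have hmem := hcont.continuousWithinAt.mem_closure_image hy
    have hsub : (fun z : E n => ‖z‖⁻¹ • z) '' C ⊆ insert 0 K := by
      rintro _ ⟨_, ⟨t, ht, k, hk, rfl⟩, rfl⟩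
      rcases ht.eq_or_lt with rfl | ht
      · simp
      · right
        have nk := mem_us.1 (hKs hk)
        simp only [norm_smul, nk, smul_smul, Real.norm_eq_abs, abs_of_pos ht, mul_one]
        rwa [inv_mul_cancel₀ ht.ne', one_smul]
    have hcl : IsClosed (insert 0 K) := by
      rw [Set.insert_eq]
      exact isClosed_singleton.union hcomp.isClosed
    have h2 := closure_minimal hsub hcl hmem
    rcases h2 with h2 | h2
    · exfalso
      have := norm_normalize hy0
      rw [h2] at this
      simp at this
    · refine ⟨‖y‖, norm_nonneg _, _, h2, ?_⟩
      rw [smul_smul, mul_inv_cancel₀ (norm_ne_zero_iff.2 hy0), one_smul]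
  have hxC : x ∉ C := by
    rintro ⟨t, ht, k, hk, rfl⟩
    have nk := mem_us.1 (hKs hk)
    rw [norm_smul, nk, mul_one, Real.norm_eq_abs, abs_of_nonneg ht] at hx
    rw [hx, one_smul] at hxK
    exact hxK hk
  obtain ⟨f, α, hf1, hf2⟩ := geometric_hahn_banach_closed_point hconv hclosed hxC
  have hα : 0 < α := by
    have := hf1 0 ⟨0, le_rfl, k₀, hk₀, by simp⟩
    simpa using this
  obtain ⟨v, rfl⟩ : ∃ v : E n, (InnerProductSpace.toDual ℝ (E n)) v = f :=
    ⟨(InnerProductSpace.toDual ℝ (E n)).symm f, by simp⟩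
  simp only [InnerProductSpace.toDual_apply_apply] at hf1 hf2
  have hcone : ∀ a ∈ K, ⟪a, v⟫ ≤ 0 := by
    intro a ha
    by_contra! hpos
    have := hf1 ((α / ⟪a, v⟫) • a) ⟨_, by positivity, a, ha, rfl⟩
    rw [real_inner_smul_right, real_inner_comm v a, div_mul_cancel₀] at this
    · exact lt_irrefl _ this
    · rw [real_inner_comm]; exact hpos.ne'
  have hv0 : v ≠ 0 := by
    rintro rfl
    rw [inner_zero_left] at hf2; linarith
  have := h _ (polar_of_cone hv0 hcone)
  rw [real_inner_smul_right, real_inner_comm] at this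
  have h3 : 0 < ‖v‖⁻¹ * ⟪v, x⟫ := mul_pos (inv_pos.2 (norm_pos_iff.2 hv0)) (by linarith)
  linarith

lemma compact_hull {n : ℕ} {s : Set (E n)} (hs : IsCompact s) :
    IsCompact (convexHull ℝ s) := by
  rcases s.eq_empty_or_nonempty with rfl | ⟨s₀, hs₀⟩
  · simp
  have : convexHull ℝ s = (fun z : (Fin (n + 2) → ℝ) × (Fin (n + 2) → E n) =>
      ∑ i, z.1 i • z.2 i) '' (stdSimplex ℝ (Fin (n + 2)) ×ˢ Set.univ.pi (fun _ => s)) := by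
    ext x
    constructor
    · intro hx
      obtain ⟨ι, _, z, w, hz, hai, hw, hw1, rfl⟩ := eq_pos_convex_span_of_mem_convexHull hx
      have hcard : Fintype.card ι ≤ n + 2 := by
        have := hai.card_le_finrank_succ
        have h2 := Submodule.finrank_le (vectorSpan ℝ (Set.range z))
        rw [finrank_euclideanSpace, Fintype.card_fin] at h2
        omega
      obtain ⟨e⟩ : Nonempty (ι ↪ Fin (n + 2)) :=
        Function.Embedding.nonempty_of_card_le (by simpa using hcard)
      refine ⟨(Function.extend e w 0, Function.extend e z (fun _ => s₀)), ⟨⟨?_, ?_⟩, ?_⟩, ?_⟩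
      · intro j
        by_cases hj : ∃ i, e i = j
        · obtain ⟨i, rfl⟩ := hj
          simp only [e.injective.extend_apply]
          exact (hw i).le
        · simp [Function.extend_apply' _ _ _ hj]
      · rw [← hw1]
        symm
        apply Fintype.sum_of_injective e e.injective
        · intro j hj
          simp only
          rw [Function.extend_apply' _ _ _ (by simpa using hj)]; rfl
        · intro i
          simp only [e.injective.extend_apply]
      · intro j _
        by_cases hj : ∃ i, e i = j
        · obtain ⟨i, rfl⟩ := hj
          simp only [e.injective.extend_apply]
          exact hz ⟨i, rfl⟩
        · simp only [Function.extend_apply' _ _ _ hj]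
          exact hs₀
      · simp only
        symm
        apply Fintype.sum_of_injective e e.injective
        · intro j hj
          rw [Function.extend_apply' _ _ _ (by simpa using hj)]; simp
        · intro i
          simp only [e.injective.extend_apply]
    · rintro ⟨⟨w, z⟩, ⟨⟨hw, hw1⟩, hz⟩, rfl⟩
      apply (convex_convexHull ℝ s).sum_mem (fun i _ => hw i) hw1
      intro i _
      exact subset_convexHull ℝ s (hz i (Set.mem_univ i))
  rw [this]
  apply IsCompact.image
  · exact (isCompact_stdSimplex ℝ _).prod (isCompact_univ_pi fun _ => hs)
  · fun_prop

lemma exists_ne_polar {n : ℕ} {K : Set (E n)} (hw : 0 < width K) :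
    ∃ u ∈ polar K, ∃ v ∈ polar K, u ≠ v := by
  by_contra! hcon
  have : {b | ∃ u v : E n, IsSupportingLune K u v ∧ b = breadth u v} = ∅ := by
    apply Set.eq_empty_of_forall_notMem
    rintro b ⟨u, v, ⟨hu, hv, hne, -, hl, -, -⟩, -⟩
    exact hne (hcon u ⟨hu, fun a ha => (hl ha).2.1⟩ v ⟨hv, fun a ha => (hl ha).2.2⟩)
  unfold width at hw
  rw [this, Real.sInf_empty] at hw
  exact lt_irrefl _ hw

lemma incenter {K : Set (E 2)} (hK : IsConvexBody K) (hw : 0 < width K) :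
    ∃ (s : ℝ) (q : E 2) (ι : Type) (_ : Fintype ι) (z : ι → E 2) (l : ι → ℝ),
      0 < s ∧ s < 1 ∧ ‖q‖ = s ∧ (∀ i, z i ∈ polar K) ∧ LinearIndependent ℝ z ∧
      (∀ i, 0 < l i) ∧ ∑ i, l i = 1 ∧ ∑ i, l i • z i = q ∧ (∀ i, ⟪z i, q⟫ = s ^ 2) ∧
      ∀ u ∈ polar K, s ^ 2 ≤ ⟪u, q⟫ := by
  obtain ⟨u₀, hu₀, v₀, hv₀, huv⟩ := exists_ne_polar hw
  obtain ⟨q, hq, hqmin⟩ := exists_norm_eq_iInf_of_complete_convex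
    (K := convexHull ℝ (polar K)) ⟨u₀, subset_convexHull ℝ _ hu₀⟩
    (compact_hull (polar_compact K)).isComplete (convex_convexHull ℝ _) 0
  rw [norm_eq_iInf_iff_real_inner_le_zero (convex_convexHull ℝ _) hq] at hqmin
  have hmin : ∀ u ∈ polar K, ‖q‖ ^ 2 ≤ ⟪u, q⟫ := by
    intro u hu
    have := hqmin u (subset_convexHull ℝ _ hu)
    rw [zero_sub, inner_neg_left, inner_sub_right, real_inner_self_eq_norm_sq,
      real_inner_comm] at this
    linarith
  obtain ⟨x, hx, hneg⟩ := exists_interior_neg hK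
  have hq0 : q ≠ 0 := by
    rintro rfl
    have hsub : convexHull ℝ (polar K) ⊆ {y | ⟪x, y⟫ < 0} := by
      apply convexHull_min hneg
      exact convex_halfSpace_lt (f := fun y => ⟪x, y⟫)
        ⟨fun a b => inner_add_right _ _ _, fun c a => real_inner_smul_right _ _ _⟩ 0
    have := hsub hq
    simp at this
  have hs0 : 0 < ‖q‖ := norm_pos_iff.2 hq0
  obtain ⟨ι, _, z, l, hz, hai, hl, hl1, hsum⟩ := eq_pos_convex_span_of_mem_convexHull hq
  have hzp : ∀ i, z i ∈ polar K := fun i => hz ⟨i, rfl⟩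
  have heq : ∀ i, ⟪z i, q⟫ = ‖q‖ ^ 2 := by
    have h1 : ∑ i, l i * (⟪z i, q⟫ - ‖q‖ ^ 2) = 0 := by
      have : ⟪∑ i, l i • z i, q⟫ = ‖q‖ ^ 2 := by rw [hsum, real_inner_self_eq_norm_sq]
      rw [sum_inner] at this
      simp only [real_inner_smul_left] at this
      simp only [mul_sub, Finset.sum_sub_distrib, this, ← Finset.sum_mul, hl1, one_mul, sub_self]
    rw [Finset.sum_eq_zero_iff_of_nonneg] at h1
    · intro i
      have := h1 i (Finset.mem_univ i)
      rcases mul_eq_zero.1 this with h | h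
      · exact absurd h (hl i).ne'
      · linarith
    · intro i _
      exact mul_nonneg (hl i).le (by linarith [hmin _ (hzp i)])
  have hlin : LinearIndependent ℝ z := by
    rw [linearIndependent_iff']
    intro t g hg i hi
    refine affineIndependent_iff.1 hai t g ?_ hg i hi
    have : ⟪∑ i ∈ t, g i • z i, q⟫ = 0 := by rw [hg, inner_zero_left]
    rw [sum_inner] at this
    simp only [real_inner_smul_left, heq, ← Finset.sum_mul] at this
    rcases mul_eq_zero.1 this with h | h
    · exact h
    · exact absurd h (by positivity)
  have hle : ‖q‖ < 1 := by
    by_contra! hge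
    have key : ∀ u ∈ polar K, u = q := by
      intro u hu
      have nu := mem_us.1 hu.1
      have h1 := hmin u hu
      have h2 := real_inner_le_norm u q
      rw [nu, one_mul] at h2
      have h3 : ‖q‖ = 1 := by nlinarith
      apply eq_of_inner_one_us nu h3
      rw [h3] at h1 h2; linarith
    exact huv ((key _ hu₀).trans (key _ hv₀).symm)
  exact ⟨‖q‖, q, ι, _, z, l, hs0, hle, rfl, hzp, hlin, hl, hl1, hsum, heq, hmin⟩

/-- `κ` : cosine of the width of the regular triangle whose inradius has sine `s`. -/
def kap (s : ℝ) : ℝ := (1 - 3 * s ^ 2) / √(1 + 3 * s ^ 2)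

lemma kap_lt {s t : ℝ} (hs : 0 ≤ s) (h : s < t) : kap t < kap s := by
  unfold kap
  have p1 : 0 < √(1 + 3 * s ^ 2) := Real.sqrt_pos.2 (by positivity)
  have p2 : 0 < √(1 + 3 * t ^ 2) := Real.sqrt_pos.2 (by positivity)
  have q1 := Real.sq_sqrt (show 0 ≤ 1 + 3 * s ^ 2 by positivity)
  have q2 := Real.sq_sqrt (show 0 ≤ 1 + 3 * t ^ 2 by positivity)
  have e1 : 1 - 3 * s ^ 2 = 2 - √(1 + 3 * s ^ 2) ^ 2 := by rw [q1]; ring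
  have e2 : 1 - 3 * t ^ 2 = 2 - √(1 + 3 * t ^ 2) ^ 2 := by rw [q2]; ring
  have hlt : √(1 + 3 * s ^ 2) < √(1 + 3 * t ^ 2) := by
    apply Real.sqrt_lt_sqrt (by positivity); nlinarith
  rw [e1, e2, div_lt_div_iff₀ p2 p1]
  generalize √(1 + 3 * s ^ 2) = a at *
  generalize √(1 + 3 * t ^ 2) = b at *
  nlinarith [mul_pos p1 p2, mul_pos (mul_pos p1 p2) (sub_pos.2 hlt)]

/-- the width bound coming from one vertex of the contact configuration -/
lemma cos_width_ge {K : Set (E 2)} (hK : IsConvexBody K) {u y : E 2} (hu : u ∈ polar K)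
    (hy : ∀ a ∈ K, ⟪a, y⟫ ≤ 0) (hy0 : ⟪u, y⟫ < ‖y‖) :
    -⟪u, y⟫ / ‖y‖ ≤ Real.cos (width K) := by
  have nu := mem_us.1 hu.1
  have hyn : y ≠ 0 := by rintro rfl; simp at hy0
  have hyp := norm_pos_iff.2 hyn
  have hv := polar_of_cone hyn hy
  have nv := mem_us.1 hv.1
  have hi : ⟪u, ‖y‖⁻¹ • y⟫ = ⟪u, y⟫ / ‖y‖ := by
    rw [real_inner_smul_right]; ring
  have hne : u ≠ ‖y‖⁻¹ • y := by
    intro h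
    have h1 : ⟪u, ‖y‖⁻¹ • y⟫ = 1 := by rw [← h]; exact inner_self_us nu
    rw [hi, div_eq_one_iff_eq hyp.ne'] at h1
    linarith
  have hw := width_le hK hu hv hne
  have b1 := inner_le_one_us nu nv
  have b2 := neg_one_le_inner_us nu nv
  have := Real.cos_le_cos_of_nonneg_of_le_pi (x := width K) ?_ (Real.arccos_le_pi _) hw
  · rw [Real.cos_arccos (by linarith) (by linarith), hi] at this
    rw [neg_div]; exact this
  · apply Real.sInf_nonneg
    rintro b ⟨u, v, -, rfl⟩
    exact Real.arccos_nonneg _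

lemma inradius_bdd {n : ℕ} {K : Set (E n)} (hne : K.Nonempty) (hK : SConvex K) :
    BddAbove {r | 0 ≤ r ∧ ∃ p ∈ unitSphere n, gball p r ⊆ K} := by
  refine ⟨π, ?_⟩
  rintro r ⟨-, p, -, hsub⟩
  by_contra! hr
  obtain ⟨hs, ⟨c, -, hc⟩, -⟩ := hK
  obtain ⟨x, hx⟩ := hne
  have h1 := hc x hx
  have h2 : -x ∈ K := hsub ⟨by rw [mem_us, norm_neg]; exact mem_us.1 (hs hx),
    (Real.arccos_le_pi _).trans hr.le⟩
  have h3 := hc _ h2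
  rw [inner_neg_right] at h3
  linarith

lemma arcsin_le_inradius {K : Set (E 2)} (hK : IsConvexBody K) {s : ℝ} {q : E 2} (hs : 0 < s)
    (hq : ‖q‖ = s) (h : ∀ u ∈ polar K, s ^ 2 ≤ ⟪u, q⟫) :
    Real.arcsin s ≤ inradius K := by
  obtain ⟨x₀, hx₀, -⟩ := exists_interior_neg hK
  apply le_csSup (inradius_bdd ⟨x₀, hx₀⟩ hK.1)
  have hp : ‖(-(s⁻¹ • q) : E 2)‖ = 1 := by
    rw [norm_neg, norm_smul, hq, Real.norm_eq_abs, abs_of_pos (inv_pos.2 hs),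
      inv_mul_cancel₀ hs.ne']
  refine ⟨Real.arcsin_nonneg.2 hs.le, -(s⁻¹ • q), mem_us.2 hp, ?_⟩
  rintro x ⟨hx, hd⟩
  have nx := mem_us.1 hx
  apply bipolar hK nx
  intro u hu
  have nu := mem_us.1 hu.1
  rw [gdist_eq_angle hp nx] at hd
  have h1 := InnerProductGeometry.angle_le_angle_add_angle (-(s⁻¹ • q)) x u
  rw [← gdist_eq_angle nx nu, ← gdist_eq_angle hp nu] at h1
  have h2 : π / 2 + Real.arcsin s ≤ gdist (-(s⁻¹ • q)) u := by
    have h3 : ⟪-(s⁻¹ • q), u⟫ ≤ -s := by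
      rw [inner_neg_left, real_inner_smul_left, real_inner_comm]
      have := h u hu
      have h4 : s ≤ s⁻¹ * ⟪u, q⟫ := by
        rw [inv_mul_eq_div, le_div_iff₀ hs]; nlinarith
      linarith
    have h4 := Real.arccos_le_arccos h3
    rw [Real.arccos, Real.arcsin_neg] at h4
    unfold gdist
    linarith
  have h5 : π / 2 ≤ gdist x u := by linarith
  unfold gdist Real.arccos at h5
  have h6 : Real.arcsin ⟪x, u⟫ ≤ 0 := by linarith
  exact Real.arcsin_nonpos.1 h6

end SphericalPal
namespace SphericalPal

/-- the spherical triangle with outer normals `u i` -/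
def Dset (u : Fin 3 → E 2) : Set (E 2) := {x ∈ unitSphere 2 | ∀ i, ⟪x, u i⟫ ≤ 0}

lemma vertex_bound {K : Set (E 2)} (hK : IsConvexBody K) {u y : E 2} (hu : u ∈ polar K)
    (hy : ∀ a ∈ K, ⟪a, y⟫ ≤ 0) {x c : ℝ} (hc : 0 < c) (hx : ⟪u, y⟫ = -x)
    (hn : ‖y‖ ^ 2 = x ^ 2 + c) : x / √(x ^ 2 + c) ≤ Real.cos (width K) := by
  have h := cos_width_ge hK hu hy (by
    rw [hx]
    apply lt_of_pow_lt_pow_left₀ 2 (norm_nonneg _)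
    rw [hn]; nlinarith)
  rw [← hn, Real.sqrt_sq (norm_nonneg _)]
  rw [hx, neg_neg] at h
  exact h

lemma kap_eq_ratio (s : ℝ) :
    kap s = (1 / 3 - s ^ 2) / √((1 / 3 - s ^ 2) ^ 2 + s ^ 2 * (1 - s ^ 2)) := by
  have : (1 / 3 - s ^ 2) ^ 2 + s ^ 2 * (1 - s ^ 2) = (1 / 3) ^ 2 * (1 + 3 * s ^ 2) := by ring
  rw [this, Real.sqrt_mul (by norm_num), Real.sqrt_sq (by norm_num)]
  have p1 : √(1 + 3 * s ^ 2) ≠ 0 := (Real.sqrt_pos.2 (by positivity)).ne'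
  unfold kap
  field_simp

lemma coef_bound {K : Set (E 2)} (hK : IsConvexBody K) {u₁ u₂ u₃ : E 2} (h1 : u₁ ∈ polar K)
    (h2 : u₂ ∈ polar K) (h3 : u₃ ∈ polar K) {γ : ℝ} (g12 : ⟪u₁, u₂⟫ = γ) (g13 : ⟪u₁, u₃⟫ = γ)
    (g23 : ⟪u₂, u₃⟫ = γ) (hγ : -1 / 2 < γ) (hγ1 : γ < 1) {a₁ a₂ a₃ : ℝ}
    (hv : a₁ • u₁ + a₂ • u₂ + a₃ • u₃ ∈ polar K) (ha : a₁ < 0) :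
    -2 * γ / √(2 + 2 * γ) < Real.cos (width K) := by
  set μ := |a₂| + |a₃| + 1 with hμ
  have μ0 : 0 < μ := by positivity
  have μ2 : a₂ ≤ μ := by have := le_abs_self a₂; have := abs_nonneg a₃; linarith
  have μ3 : a₃ ≤ μ := by have := le_abs_self a₃; have := abs_nonneg a₂; linarith
  have n1 := inner_self_us (mem_us.1 h1.1)
  have n2 := inner_self_us (mem_us.1 h2.1)
  have n3 := inner_self_us (mem_us.1 h3.1)
  have g21 : ⟪u₂, u₁⟫ = γ := by rw [real_inner_comm]; exact g12
  have g31 : ⟪u₃, u₁⟫ = γ := by rw [real_inner_comm]; exact g13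
  have g32 : ⟪u₃, u₂⟫ = γ := by rw [real_inner_comm]; exact g23
  have hcc : 0 < 2 + 2 * γ - 4 * γ ^ 2 := by nlinarith
  have hc : 0 < μ ^ 2 * (2 + 2 * γ - 4 * γ ^ 2) := by positivity
  have hb := vertex_bound hK h1 (y := a₁ • u₁ + μ • u₂ + μ • u₃) (x := -a₁ - 2 * μ * γ)
    (c := μ ^ 2 * (2 + 2 * γ - 4 * γ ^ 2)) ?_ hc ?_ ?_
  · have hr := ratio_lt (x := -2 * μ * γ) (y := -a₁ - 2 * μ * γ) hc (by linarith)
    have e : (-2 * μ * γ) ^ 2 + μ ^ 2 * (2 + 2 * γ - 4 * γ ^ 2) = μ ^ 2 * (2 + 2 * γ) := by ring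
    rw [e, Real.sqrt_mul (by positivity), Real.sqrt_sq μ0.le] at hr
    have e2 : -2 * μ * γ / (μ * √(2 + 2 * γ)) = -2 * γ / √(2 + 2 * γ) := by
      rw [show -2 * μ * γ = μ * (-2 * γ) by ring, mul_div_mul_left _ _ μ0.ne']
    rw [e2] at hr
    linarith
  · intro a ha
    have e : a₁ • u₁ + μ • u₂ + μ • u₃ = (a₁ • u₁ + a₂ • u₂ + a₃ • u₃) + (μ - a₂) • u₂
        + (μ - a₃) • u₃ := by module
    rw [e, inner_add_right, inner_add_right, real_inner_smul_right, real_inner_smul_right]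
    have i1 := hv.2 a ha
    have i2 := mul_nonneg (sub_nonneg.2 μ2) (neg_nonneg.2 (h2.2 a ha))
    have i3 := mul_nonneg (sub_nonneg.2 μ3) (neg_nonneg.2 (h3.2 a ha))
    linarith
  · simp only [inner_add_right, real_inner_smul_right, n1, g12, g13]
    ring
  · rw [← real_inner_self_eq_norm_sq]
    simp only [inner_add_right, inner_add_left, real_inner_smul_right, real_inner_smul_left,
      n1, n2, n3, g12, g13, g23, g21, g31, g32]
    ring

lemma K_main {K : Set (E 2)} (hK : IsConvexBody K) (hw : 0 < width K) :
    ∃ s : ℝ, 0 < s ∧ s < 1 ∧ Real.arcsin s ≤ inradius K ∧ kap s ≤ Real.cos (width K) ∧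
      (kap s = Real.cos (width K) → ∃ u : Fin 3 → E 2, (∀ i, ‖u i‖ = 1) ∧
        (∀ i j, i ≠ j → ⟪u i, u j⟫ = (3 * s ^ 2 - 1) / 2) ∧ LinearIndependent ℝ u ∧
        K = Dset u) := by
  obtain ⟨s, q, ι, _, z, l, hs0, hs1, hq, hzp, hlin, hl, hl1, hsum, heq, hmin⟩ := incenter hK hw
  classical
  have hcard : Fintype.card ι ≤ 3 := by
    have := hlin.fintype_card_le_finrank
    simpa using this
  have hc : 0 < s ^ 2 * (1 - s ^ 2) := by
    have : s ^ 2 < 1 := by nlinarith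
    have : 0 < 1 - s ^ 2 := by linarith
    positivity
  have hvb : ∀ i, (l i - s ^ 2) / √((l i - s ^ 2) ^ 2 + s ^ 2 * (1 - s ^ 2)) ≤
      Real.cos (width K) := by
    intro i
    have nz := mem_us.1 (hzp i).1
    apply vertex_bound hK (hzp i) (y := q - l i • z i) _ hc
    · rw [inner_sub_right, real_inner_smul_right, heq, inner_self_us nz]; ring
    · rw [norm_sub_sq_real, hq, norm_smul, nz, real_inner_smul_right, real_inner_comm, heq,
        Real.norm_eq_abs, mul_one, sq_abs]; ring
    · intro a ha
      have : q - l i • z i = ∑ j ∈ Finset.univ.erase i, l j • z j := by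
        rw [← hsum, ← Finset.add_sum_erase _ _ (Finset.mem_univ i)]; simp
      rw [this, inner_sum]
      apply Finset.sum_nonpos
      intro j _
      rw [real_inner_smul_right]
      exact mul_nonpos_of_nonneg_of_nonpos (hl j).le ((hzp j).2 a ha)
  refine ⟨s, hs0, hs1, arcsin_le_inradius hK hs0 hq hmin, ?_, ?_⟩
  · obtain ⟨i, hi⟩ : ∃ i, 1 / 3 ≤ l i := by
      by_contra! hcon
      have hne : (Finset.univ : Finset ι).Nonempty := by
        rw [Finset.nonempty_iff_ne_empty]
        intro h; rw [h] at hl1; simp at hl1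
      have := Finset.sum_lt_sum_of_nonempty hne (fun i _ => hcon i)
      rw [hl1] at this
      simp only [Finset.sum_const, Finset.card_univ, nsmul_eq_mul] at this
      have h3 : (Fintype.card ι : ℝ) ≤ 3 := by exact_mod_cast hcard
      linarith
    rw [kap_eq_ratio]
    rcases hi.eq_or_lt with h | h
    · rw [h]; exact hvb i
    · exact (ratio_lt hc (by linarith)).le.trans (hvb i)
  · intro hk
    have hle : ∀ i, l i ≤ 1 / 3 := by
      intro i
      by_contra! hcon
      have h1 := ratio_lt hc (show 1 / 3 - s ^ 2 < l i - s ^ 2 by linarith)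
      rw [← kap_eq_ratio, hk] at h1
      linarith [hvb i]
    have hcard3 : Fintype.card ι = 3 := by
      apply le_antisymm hcard
      have := Finset.sum_le_sum (fun i (_ : i ∈ Finset.univ) => hle i)
      rw [hl1] at this
      simp only [Finset.sum_const, Finset.card_univ, nsmul_eq_mul] at this
      have h3 : (3 : ℝ) ≤ Fintype.card ι := by linarith
      exact_mod_cast h3
    have hl3 : ∀ i, l i = 1 / 3 := by
      have : ∑ i, (1 / 3 - l i) = 0 := by
        rw [Finset.sum_sub_distrib, hl1]
        simp [hcard3]
      rw [Finset.sum_eq_zero_iff_of_nonneg (fun i _ => by linarith [hle i])] at this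
      intro i
      have := this i (Finset.mem_univ i)
      linarith
    let e : Fin 3 ≃ ι := (Fintype.equivFinOfCardEq hcard3).symm
    have hS : z (e 0) + z (e 1) + z (e 2) = (3 : ℝ) • q := by
      rw [← hsum, ← Equiv.sum_comp e, Fin.sum_univ_three, hl3, hl3, hl3]
      module
    set u : Fin 3 → E 2 := z ∘ e with hu
    have hup : ∀ i, u i ∈ polar K := fun i => hzp _
    have hS' : u 0 + u 1 + u 2 = (3 : ℝ) • q := hS
    have nu : ∀ i, ‖u i‖ = 1 := fun i => mem_us.1 (hup i).1
    have hin : ∀ i, ⟪u i, u 0⟫ + ⟪u i, u 1⟫ + ⟪u i, u 2⟫ = 3 * s ^ 2 := by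
      intro i
      rw [← inner_add_right, ← inner_add_right, hS', real_inner_smul_right]
      rw [show ⟪u i, q⟫ = s ^ 2 from heq _]
    have i0 := hin 0
    have i1 := hin 1
    have i2 := hin 2
    rw [inner_self_us (nu _)] at i0 i1 i2
    rw [real_inner_comm (u 0) (u 1)] at i1
    rw [real_inner_comm (u 0) (u 2), real_inner_comm (u 1) (u 2)] at i2
    have g01 : ⟪u 0, u 1⟫ = (3 * s ^ 2 - 1) / 2 := by linarith
    have g02 : ⟪u 0, u 2⟫ = (3 * s ^ 2 - 1) / 2 := by linarith
    have g12 : ⟪u 1, u 2⟫ = (3 * s ^ 2 - 1) / 2 := by linarith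
    have g10 : ⟪u 1, u 0⟫ = (3 * s ^ 2 - 1) / 2 := by rw [real_inner_comm]; exact g01
    have g20 : ⟪u 2, u 0⟫ = (3 * s ^ 2 - 1) / 2 := by rw [real_inner_comm]; exact g02
    have g21 : ⟪u 2, u 1⟫ = (3 * s ^ 2 - 1) / 2 := by rw [real_inner_comm]; exact g12
    have hlu : LinearIndependent ℝ u := hlin.comp e e.injective
    have hkk : -2 * ((3 * s ^ 2 - 1) / 2) / √(2 + 2 * ((3 * s ^ 2 - 1) / 2)) =
        Real.cos (width K) := by
      rw [← hk, kap]
      congr 1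
      · ring
      · congr 1; ring
    have hγ : -1 / 2 < (3 * s ^ 2 - 1) / 2 := by nlinarith
    have hγ1 : (3 * s ^ 2 - 1) / 2 < 1 := by nlinarith
    refine ⟨u, nu, ?_, hlu, ?_⟩
    · intro i j hij
      fin_cases i <;> fin_cases j <;> first | exact absurd rfl hij | assumption
    · apply Set.Subset.antisymm
      · intro x hx
        exact ⟨hK.1.1 hx, fun i => (hup i).2 x hx⟩
      · rintro x ⟨hx, hxu⟩
        apply bipolar hK (mem_us.1 hx)
        intro v hv
        let b := basisOfLinearIndependentOfCardEqFinrank hlu (by simp)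
        have hb : ∀ i, b i = u i := fun i => by simp [b]
        have hrep := b.sum_repr v
        rw [Fin.sum_univ_three, hb, hb, hb] at hrep
        generalize b.repr v 0 = a0 at hrep
        generalize b.repr v 1 = a1 at hrep
        generalize b.repr v 2 = a2 at hrep
        subst hrep
        have p0 : 0 ≤ a0 := by
          by_contra! hneg
          exact (coef_bound hK (hup 0) (hup 1) (hup 2) g01 g02 g12 hγ hγ1 hv hneg).ne hkk
        have p1 : 0 ≤ a1 := by
          by_contra! hneg
          rw [add_comm (a0 • u 0)] at hv
          exact (coef_bound hK (hup 1) (hup 0) (hup 2) g10 g12 g02 hγ hγ1 hv hneg).ne hkk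
        have p2 : 0 ≤ a2 := by
          by_contra! hneg
          rw [add_comm, ← add_assoc] at hv
          exact (coef_bound hK (hup 2) (hup 0) (hup 1) g20 g21 g01 hγ hγ1 hv hneg).ne hkk
        simp only [inner_add_right, real_inner_smul_right]
        have q0 := mul_nonneg p0 (neg_nonneg.2 (hxu 0))
        have q1 := mul_nonneg p1 (neg_nonneg.2 (hxu 1))
        have q2 := mul_nonneg p2 (neg_nonneg.2 (hxu 2))
        linarith

end SphericalPal
namespace SphericalPal

lemma alg_same {g a b c d : ℝ} (hg0 : 0 ≤ g) (hg1 : g ≤ 1 / 2) (ha : 0 ≤ a) (hb : 0 ≤ b)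
    (hc : 0 ≤ c) (hd : 0 ≤ d) (h1 : a ^ 2 + b ^ 2 - 2 * g * (a * b) = 1)
    (h2 : c ^ 2 + d ^ 2 - 2 * g * (c * d) = 1) :
    -(a * c + b * d - g * (a * d + b * c)) ≤ g := by
  have hX : a * d + b * c - g * (a * c + b * d) ≤ 1 := by
    have : 0 ≤ (a - d) ^ 2 + (b - c) ^ 2 - 2 * g * ((a - d) * (b - c)) := by
      nlinarith [sq_nonneg ((a - d) + (b - c)), sq_nonneg ((a - d) - (b - c))]
    nlinarith
  have h3 := mul_le_mul_of_nonneg_left hX hg0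
  have h4 : 0 ≤ a * c + b * d := by positivity
  nlinarith [mul_nonneg h4 (show 0 ≤ 1 - g ^ 2 by nlinarith)]

lemma alg_diff {g h a b c d : ℝ} (hg0 : 0 ≤ g) (hg1 : g ≤ 1 / 2) (hb : 0 ≤ b) (hd : 0 ≤ d)
    (hh : 0 < h) (hh2 : h ^ 2 = 2 - 2 * g)
    (h1 : a ^ 2 + b ^ 2 - 2 * g * (a * b) = 1)
    (h2 : c ^ 2 + d ^ 2 - 2 * g * (c * d) = 1) :
    -(b * d - g * (a * c + a * d + b * c)) ≤ 2 * g / h := by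
  set M := a * (c + d) + b * (c - (1 + 2 * g) * d) with hM
  have hid : 2 * (a ^ 2 + b ^ 2 - 2 * g * (a * b)) * (c ^ 2 + d ^ 2 - 2 * g * (c * d)) -
      (1 - g) * M ^ 2 = (1 + g) * (a * (c - d) - b * (c + (1 - 2 * g) * d)) ^ 2 := by
    rw [hM]; ring
  rw [h1, h2] at hid
  have hM2 : (M * h) ^ 2 ≤ 2 ^ 2 := by
    rw [mul_pow, hh2]
    have : 0 ≤ (1 + g) * (a * (c - d) - b * (c + (1 - 2 * g) * d)) ^ 2 := by positivity
    nlinarith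
  have hMh : M * h ≤ 2 := le_of_sq_le_sq hM2 (by norm_num)
  rw [le_div_iff₀ hh]
  have h3 : -(b * d - g * (a * c + a * d + b * c)) ≤ g * M := by
    rw [hM]
    nlinarith [mul_nonneg (mul_nonneg hb hd) (show 0 ≤ 1 - g * (1 + 2 * g) by nlinarith)]
  nlinarith [mul_le_mul_of_nonneg_right h3 hh.le, mul_le_mul_of_nonneg_left hMh hg0]

lemma cone_add {n : ℕ} {C : Set (E n)} (hC : SConvex C) {k₁ k₂ : E n} (h1 : k₁ ∈ C) (h2 : k₂ ∈ C)
    {a b : ℝ} (ha : 0 ≤ a) (hb : 0 ≤ b) : ∃ t : ℝ, 0 ≤ t ∧ ∃ k ∈ C, a • k₁ + b • k₂ = t • k := by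
  by_cases hz : a • k₁ + b • k₂ = 0
  · rw [hz]; exact ⟨0, le_rfl, k₁, h1, by simp⟩
  · refine ⟨‖a • k₁ + b • k₂‖, norm_nonneg _, _, hC.2.2 k₁ h1 k₂ h2
      (seg_mem_of_comb (mem_us.1 (hC.1 h1)) (mem_us.1 (hC.1 h2)) ha hb hz), ?_⟩
    rw [smul_smul, mul_inv_cancel₀ (norm_ne_zero_iff.2 hz), one_smul]

lemma cos_width_le {T : Set (E 2)} (h0 : 0 < width T) (hpi : width T ≤ π) {k : ℝ} (hk0 : -1 ≤ k)
    (hk1 : k ≤ 1) (h : ∀ u v, IsSupportingLune T u v → -⟪u, v⟫ ≤ k) :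
    Real.cos (width T) ≤ k := by
  have hne : {b | ∃ u v : E 2, IsSupportingLune T u v ∧ b = breadth u v}.Nonempty := by
    by_contra hcon
    rw [Set.not_nonempty_iff_eq_empty] at hcon
    unfold width at h0
    rw [hcon, Real.sInf_empty] at h0
    exact lt_irrefl _ h0
  have h1 : Real.arccos k ≤ width T := by
    apply le_csInf hne
    rintro b ⟨u, v, hs, rfl⟩
    rw [breadth_eq (mem_us.1 hs.1) (mem_us.1 hs.2.1) hs.2.2.1 hs.2.2.2.1]
    exact Real.arccos_le_arccos (h u v hs)
  have := Real.cos_le_cos_of_nonneg_of_le_pi (Real.arccos_nonneg k) hpi h1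
  rwa [Real.cos_arccos hk0 hk1] at this

lemma ball_bound {p u : E 2} {r : ℝ} {T : Set (E 2)} (hp : ‖p‖ = 1) (hu : ‖u‖ = 1) (hr0 : 0 ≤ r)
    (hr : r ≤ π / 2) (hsub : gball p r ⊆ T) (hT : ∀ x ∈ T, ⟪x, u⟫ ≤ 0) :
    ⟪p, u⟫ ≤ -Real.sin r := by
  by_cases h0 : u - ⟪p, u⟫ • p = 0
  · have hpT : p ∈ T := hsub ⟨mem_us.2 hp, by
      unfold gdist; rw [inner_self_us hp, Real.arccos_one]; exact hr0⟩
    have h1 := hT p hpT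
    have h2 : u = ⟪p, u⟫ • p := sub_eq_zero.1 h0
    have h3 : ‖u‖ = |⟪p, u⟫| := by
      conv_lhs => rw [h2]
      rw [norm_smul, hp, mul_one, Real.norm_eq_abs]
    rw [hu, abs_of_nonpos h1] at h3
    have := Real.sin_le_one r
    linarith
  · set m := u - ⟪p, u⟫ • p with hm
    have hmp := norm_pos_iff.2 h0
    have hpm : ⟪p, m⟫ = 0 := by
      rw [hm, inner_sub_right, real_inner_smul_right, inner_self_us hp]; ring
    have hmu : ⟪m, u⟫ = ‖m‖ ^ 2 := by
      have : u = m + ⟪p, u⟫ • p := by rw [hm]; abel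
      conv_lhs => rw [this]
      rw [inner_add_right, real_inner_smul_right, real_inner_comm p m, hpm,
        real_inner_self_eq_norm_sq]; ring
    have hm2 : ‖m‖ ^ 2 = 1 - ⟪p, u⟫ ^ 2 := by
      rw [← hmu, hm, inner_sub_left, real_inner_smul_left, inner_self_us hu]; ring
    have nx : ‖(Real.cos r • p + (Real.sin r * ‖m‖⁻¹) • m : E 2)‖ = 1 := by
      rw [← sq_eq_sq₀ (norm_nonneg _) zero_le_one, norm_add_sq_real, norm_smul, norm_smul, hp,
        real_inner_smul_left, real_inner_smul_right, hpm]
      simp only [Real.norm_eq_abs, abs_mul, abs_inv, abs_norm, mul_one, mul_zero, add_zero]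
      rw [mul_assoc, inv_mul_cancel₀ hmp.ne', mul_one, sq_abs, sq_abs]
      simp
    have hx := hT _ (hsub ⟨mem_us.2 nx, by
      unfold gdist
      rw [inner_add_right, real_inner_smul_right, real_inner_smul_right, hpm, inner_self_us hp]
      simp only [mul_one, mul_zero, add_zero]
      rw [Real.arccos_cos hr0 (by linarith [Real.pi_pos])]⟩)
    rw [inner_add_left, real_inner_smul_left, real_inner_smul_left, hmu] at hx
    have e : Real.sin r * ‖m‖⁻¹ * ‖m‖ ^ 2 = Real.sin r * ‖m‖ := by field_simp
    rw [e] at hx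
    have b1 := inner_le_one_us hp hu
    have b2 := neg_one_le_inner_us hp hu
    have hms : ‖m‖ = Real.sin (Real.arccos ⟪p, u⟫) := by
      rw [Real.sin_arccos, ← hm2, Real.sqrt_sq hmp.le]
    have hpc : ⟪p, u⟫ = Real.cos (Real.arccos ⟪p, u⟫) := (Real.cos_arccos b2 b1).symm
    have hcos : Real.cos (Real.arccos ⟪p, u⟫ - r) ≤ 0 := by
      rw [Real.cos_sub, ← hms, ← hpc]; linarith
    have h5 : π / 2 + r ≤ Real.arccos ⟪p, u⟫ := by
      by_contra! hlt
      rcases lt_or_ge (-(π / 2)) (Real.arccos ⟪p, u⟫ - r) with h6 | h6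
      · have := Real.cos_pos_of_mem_Ioo ⟨h6, by linarith⟩
        linarith
      · have h7 := Real.arccos_nonneg ⟪p, u⟫
        have h8 : r = π / 2 := by linarith
        have h9 : Real.arccos ⟪p, u⟫ = 0 := by linarith
        have hpT : p ∈ T := hsub ⟨mem_us.2 hp, by
          unfold gdist; rw [inner_self_us hp, Real.arccos_one]; exact hr0⟩
        have h1 := hT p hpT
        rw [Real.arccos_eq_zero] at h9
        linarith
    have h6 := Real.cos_le_cos_of_nonneg_of_le_pi (by linarith [Real.pi_pos])
      (Real.arccos_le_pi ⟪p, u⟫) h5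
    rw [← hpc, add_comm (π / 2) r, Real.cos_add_pi_div_two] at h6
    exact h6

lemma inradius_D_le {u : Fin 3 → E 2} (nu : ∀ i, ‖u i‖ = 1) {s : ℝ} (hs0 : 0 < s) (hs1 : s < 1)
    (hg : ∀ i j, i ≠ j → ⟪u i, u j⟫ = (3 * s ^ 2 - 1) / 2) :
    inradius (Dset u) ≤ Real.arcsin s := by
  apply Real.sSup_le _ (Real.arcsin_nonneg.2 hs0.le)
  rintro r ⟨hr0, p, hp, hsub⟩
  have np := mem_us.1 hp
  have hS : ‖u 0 + u 1 + u 2‖ = 3 * s := by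
    rw [← sq_eq_sq₀ (norm_nonneg _) (by positivity), ← real_inner_self_eq_norm_sq]
    simp only [inner_add_left, inner_add_right, inner_self_us (nu _), hg 0 1 (by decide),
      hg 0 2 (by decide), hg 1 2 (by decide), hg 1 0 (by decide), hg 2 0 (by decide),
      hg 2 1 (by decide)]
    ring
  have key : ∀ t, 0 ≤ t → t ≤ π / 2 → t ≤ r → Real.sin t ≤ s := by
    intro t ht0 ht1 htr
    have hsub' : gball p t ⊆ Dset u := fun x hx => hsub ⟨hx.1, hx.2.trans htr⟩
    have b := fun i => ball_bound np (nu i) ht0 ht1 hsub' (fun x hx => hx.2 i)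
    have h1 := b 0
    have h2 := b 1
    have h3 := b 2
    have h4 := abs_real_inner_le_norm p (u 0 + u 1 + u 2)
    rw [np, hS, inner_add_right, inner_add_right] at h4
    have := (abs_le.1 h4).1
    linarith
  rcases le_or_gt r (π / 2) with h | h
  · exact (Real.le_arcsin_iff_sin_le' ⟨by linarith [Real.pi_pos], h⟩).2 (key r hr0 h le_rfl)
  · have := key (π / 2) (by positivity) le_rfl h.le
    rw [Real.sin_pi_div_two] at this
    linarith

lemma T_width {u : Fin 3 → E 2} (nu : ∀ i, ‖u i‖ = 1) {g : ℝ} (hg1 : g < 1 / 2)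
    (hgm : -1 < g)
    (hg : ∀ i j, i ≠ j → ⟪u i, u j⟫ = -g) {T : Set (E 2)} (h0 : 0 < width T)
    (hpi : width T ≤ π / 2)
    (hsup : ∀ x, (∀ y ∈ T, ⟪y, x⟫ ≤ 0) → (∃ y ∈ T, ⟪y, x⟫ = 0) →
      ∃ a : Fin 3 → ℝ, (∀ i, 0 ≤ a i) ∧ (∃ i, a i = 0) ∧
        x = a 0 • u 0 + a 1 • u 1 + a 2 • u 2) :
    0 ≤ g ∧ Real.cos (width T) ≤ 2 * g / √(2 - 2 * g) := by
  have G : ∀ a b : Fin 3 → ℝ, ⟪a 0 • u 0 + a 1 • u 1 + a 2 • u 2,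
      b 0 • u 0 + b 1 • u 1 + b 2 • u 2⟫ = a 0 * b 0 + a 1 * b 1 + a 2 * b 2 -
      g * (a 0 * b 1 + a 1 * b 0 + a 0 * b 2 + a 2 * b 0 + a 1 * b 2 + a 2 * b 1) := by
    intro a b
    simp only [inner_add_left, inner_add_right, real_inner_smul_left, real_inner_smul_right,
      inner_self_us (nu _), hg 0 1 (by decide),
      hg 0 2 (by decide), hg 1 2 (by decide), hg 1 0 (by decide), hg 2 0 (by decide),
      hg 2 1 (by decide)]
    ring
  have hlune : ∀ p q, IsSupportingLune T p q → ∃ a b : Fin 3 → ℝ, (∀ i, 0 ≤ a i) ∧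
      (∀ i, 0 ≤ b i) ∧ (∃ i, a i = 0) ∧ (∃ i, b i = 0) ∧
      a 0 * a 0 + a 1 * a 1 + a 2 * a 2 -
      g * (a 0 * a 1 + a 1 * a 0 + a 0 * a 2 + a 2 * a 0 + a 1 * a 2 + a 2 * a 1) = 1 ∧
      b 0 * b 0 + b 1 * b 1 + b 2 * b 2 -
      g * (b 0 * b 1 + b 1 * b 0 + b 0 * b 2 + b 2 * b 0 + b 1 * b 2 + b 2 * b 1) = 1 ∧
      ⟪p, q⟫ = a 0 * b 0 + a 1 * b 1 + a 2 * b 2 -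
      g * (a 0 * b 1 + a 1 * b 0 + a 0 * b 2 + a 2 * b 0 + a 1 * b 2 + a 2 * b 1) := by
    rintro p q ⟨hp, hq, -, -, hl, ⟨x, hx, -, hx0, -⟩, ⟨y, hy, -, hy0, -⟩⟩
    obtain ⟨a, ha, ha0, rfl⟩ := hsup p (fun y hy => (hl hy).2.1) ⟨x, hx, hx0⟩
    obtain ⟨b, hb, hb0, rfl⟩ := hsup q (fun y hy => (hl hy).2.2) ⟨y, hy, hy0⟩
    refine ⟨a, b, ha, hb, ha0, hb0, ?_, ?_, G a b⟩
    · rw [← G]; exact inner_self_us (mem_us.1 hp)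
    · rw [← G]; exact inner_self_us (mem_us.1 hq)
  have hpi' : width T ≤ π := by linarith [Real.pi_pos]
  have hg0 : 0 ≤ g := by
    by_contra! hneg
    have := cos_width_le h0 hpi' (k := g) (by linarith) (by linarith) (by
      intro p q hs
      obtain ⟨a, b, ha, hb, -, -, h1, h2, h3⟩ := hlune p q hs
      have A0 := ha 0
      have A1 := ha 1
      have A2 := ha 2
      have B0 := hb 0
      have B1 := hb 1
      have B2 := hb 2
      rw [h3]
      have sa : 1 ≤ (a 0 + a 1 + a 2) := by
        have : 1 ^ 2 ≤ (a 0 + a 1 + a 2) ^ 2 := by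
          have : 0 ≤ (1 + g) * (a 0 * a 1 + a 0 * a 2 + a 1 * a 2) :=
            mul_nonneg (by linarith) (by positivity)
          nlinarith
        exact le_of_sq_le_sq this (by positivity)
      have sb : 1 ≤ (b 0 + b 1 + b 2) := by
        have : 1 ^ 2 ≤ (b 0 + b 1 + b 2) ^ 2 := by
          have : 0 ≤ (1 + g) * (b 0 * b 1 + b 0 * b 2 + b 1 * b 2) :=
            mul_nonneg (by linarith) (by positivity)
          nlinarith
        exact le_of_sq_le_sq this (by positivity)
      have sab : 1 ≤ (a 0 + a 1 + a 2) * (b 0 + b 1 + b 2) := one_le_mul_of_one_le_of_one_le sa sb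
      have hd : 0 ≤ (1 + g) * (a 0 * b 0 + a 1 * b 1 + a 2 * b 2) :=
        mul_nonneg (by linarith) (by positivity)
      have := mul_le_mul_of_nonneg_left sab (neg_nonneg.2 hneg.le)
      linarith)
    have h2 := Real.cos_nonneg_of_neg_pi_div_two_le_of_le (x := width T)
      (by linarith [Real.pi_pos]) hpi
    linarith
  have hh : 0 < √(2 - 2 * g) := Real.sqrt_pos.2 (by linarith)
  have hh2 := Real.sq_sqrt (show 0 ≤ 2 - 2 * g by linarith)
  have hk1 : 2 * g / √(2 - 2 * g) ≤ 1 := by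
    rw [div_le_one hh]
    apply Real.le_sqrt_of_sq_le
    nlinarith
  have hk2 : g ≤ 2 * g / √(2 - 2 * g) := by
    rw [le_div_iff₀ hh]
    have : √(2 - 2 * g) ≤ 2 := by
      rw [Real.sqrt_le_left (by norm_num)]; linarith
    nlinarith
  have hk0 : 0 ≤ 2 * g / √(2 - 2 * g) := by positivity
  have KD : ∀ a b c d : ℝ, 0 ≤ b → 0 ≤ d → a ^ 2 + b ^ 2 - 2 * g * (a * b) = 1 →
      c ^ 2 + d ^ 2 - 2 * g * (c * d) = 1 →
      -(b * d - g * (a * c + a * d + b * c)) ≤ 2 * g / √(2 - 2 * g) :=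
    fun a b c d hb hd h1 h2 => alg_diff hg0 hg1.le hb hd hh hh2 h1 h2
  refine ⟨hg0, cos_width_le h0 hpi' (by linarith) hk1 ?_⟩
  intro p q hs
  obtain ⟨a, b, ha, hb, ⟨i, hi⟩, ⟨j, hj⟩, h1, h2, h3⟩ := hlune p q hs
  have A0 := ha 0
  have A1 := ha 1
  have A2 := ha 2
  have B0 := hb 0
  have B1 := hb 1
  have B2 := hb 2
  rw [h3]
  generalize 2 * g / √(2 - 2 * g) = k at hk1 hk2 hk0 KD ⊢
  fin_cases i <;> fin_cases j <;> simp only [Fin.zero_eta, Fin.mk_one, Fin.reduceFinMk] at hi hj <;>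
    rw [hi] at h1 <;> rw [hj] at h2 <;> rw [hi, hj]
  · have := alg_same hg0 hg1.le A1 A2 B1 B2 (by linarith) (by linarith)
    linarith
  · have := KD (a 1) (a 2) (b 0) (b 2) A2 B2 (by linarith) (by linarith)
    linarith
  · have := KD (a 2) (a 1) (b 0) (b 1) A1 B1 (by linarith) (by linarith)
    linarith
  · have := KD (a 0) (a 2) (b 1) (b 2) A2 B2 (by linarith) (by linarith)
    linarith
  · have := alg_same hg0 hg1.le A0 A2 B0 B2 (by linarith) (by linarith)
    linarith
  · have := KD (a 2) (a 0) (b 1) (b 0) A0 B0 (by linarith) (by linarith)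
    linarith
  · have := KD (a 0) (a 1) (b 2) (b 1) A1 B1 (by linarith) (by linarith)
    linarith
  · have := KD (a 1) (a 0) (b 2) (b 0) A0 B0 (by linarith) (by linarith)
    linarith
  · have := alg_same hg0 hg1.le A0 A1 B0 B1 (by linarith) (by linarith)
    linarith

end SphericalPal
namespace SphericalPal

lemma expand {v : Fin 3 → E 2} (hv : LinearIndependent ℝ v) (x : E 2) :
    ∃ a : Fin 3 → ℝ, x = a 0 • v 0 + a 1 • v 1 + a 2 • v 2 := by
  let b := basisOfLinearIndependentOfCardEqFinrank hv (by simp)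
  refine ⟨fun i => b.repr x i, ?_⟩
  have h := b.sum_repr x
  rw [Fin.sum_univ_three] at h
  simp only [b, coe_basisOfLinearIndependentOfCardEqFinrank] at h
  exact h.symm

lemma dual_exists {v : Fin 3 → E 2} (nv : ∀ i, ‖v i‖ = 1) {c : ℝ} (hc1 : c < 1)
    (hc2 : -1 / 2 < c) (hc : ∀ i j, i ≠ j → ⟪v i, v j⟫ = c) :
    ∃ (u : Fin 3 → E 2) (δ g : ℝ), 0 < δ ∧ -1 < g ∧ g < 1 / 2 ∧ (∀ i, ‖u i‖ = 1) ∧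
      (∀ i, ⟪v i, u i⟫ = -δ) ∧ (∀ i j, i ≠ j → ⟪v i, u j⟫ = 0) ∧
      (∀ i j, i ≠ j → ⟪u i, u j⟫ = -g) := by
  have hpos : 0 < (1 + c) * (1 - c) * (1 + 2 * c) :=
    mul_pos (mul_pos (by linarith) (by linarith)) (by linarith)
  set ν := √((1 + c) * (1 - c) * (1 + 2 * c)) with hν
  have νpos : 0 < ν := Real.sqrt_pos.2 hpos
  have ν2 : ν ^ 2 = (1 + c) * (1 - c) * (1 + 2 * c) := Real.sq_sqrt hpos.le
  set V := v 0 + v 1 + v 2 with hV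
  have hVv : ∀ k, ⟪v k, V⟫ = 1 + 2 * c := by
    intro k
    fin_cases k <;>
    simp [hV, inner_add_right, nv, hc 0 1 (by decide),
      hc 0 2 (by decide), hc 1 2 (by decide), hc 1 0 (by decide), hc 2 0 (by decide),
      hc 2 1 (by decide)] <;> ring
  let w : Fin 3 → E 2 := fun i => (1 + 2 * c) • v i - c • V
  have hvw : ∀ i, ⟪v i, w i⟫ = (1 + 2 * c) * (1 - c) := by
    intro i
    simp only [w, inner_sub_right, real_inner_smul_right, hVv, inner_self_us (nv i)]; ring
  have hvw' : ∀ i j, i ≠ j → ⟪v i, w j⟫ = 0 := by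
    intro i j hij
    simp only [w, inner_sub_right, real_inner_smul_right, hVv, hc i j hij]; ring
  have hVw : ∀ i, ⟪V, w i⟫ = (1 + 2 * c) * (1 - c) := by
    intro i
    fin_cases i
    · simp only [hV, inner_add_left]
      rw [Fin.zero_eta, hvw 0, hvw' 1 0 (by decide), hvw' 2 0 (by decide)]; ring
    · simp only [hV, inner_add_left]
      rw [Fin.mk_one, hvw 1, hvw' 0 1 (by decide), hvw' 2 1 (by decide)]; ring
    · simp only [hV, inner_add_left]
      simp only [Fin.reduceFinMk]; rw [hvw 2, hvw' 1 2 (by decide), hvw' 0 2 (by decide)]; ring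
  have hww : ∀ i, ⟪w i, w i⟫ = ν ^ 2 := by
    intro i
    conv_lhs => enter [2]; simp only [w]
    rw [inner_sub_left, real_inner_smul_left, real_inner_smul_left, hvw, hVw, ν2]; ring
  have hww' : ∀ i j, i ≠ j → ⟪w i, w j⟫ = -c * ((1 + 2 * c) * (1 - c)) := by
    intro i j hij
    conv_lhs => enter [2]; simp only [w]
    rw [inner_sub_left, real_inner_smul_left, real_inner_smul_left, hvw' i j hij, hVw]; ring
  refine ⟨fun i => (-ν⁻¹) • w i, ν⁻¹ * ((1 + 2 * c) * (1 - c)), c / (1 + c), ?_, ?_, ?_, ?_, ?_,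
    ?_, ?_⟩
  · exact mul_pos (inv_pos.2 νpos) (mul_pos (by linarith) (by linarith))
  · rw [lt_div_iff₀ (by linarith)]; linarith
  · rw [div_lt_iff₀ (by linarith)]; linarith
  · intro i
    rw [← sq_eq_sq₀ (norm_nonneg _) zero_le_one, ← real_inner_self_eq_norm_sq,
      real_inner_smul_left, real_inner_smul_right, hww]
    field_simp
  · intro i
    simp only [real_inner_smul_right, hvw]; ring
  · intro i j hij
    simp only [real_inner_smul_right, hvw' i j hij]; ring
  · intro i j hij
    simp only [real_inner_smul_left, real_inner_smul_right, hww' i j hij]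
    have h1 : (1 + c) ≠ 0 := by linarith
    have h2 : -ν⁻¹ * (-ν⁻¹ * (-c * ((1 + 2 * c) * (1 - c)))) =
      -c * ((1 + 2 * c) * (1 - c)) / ν ^ 2 := by field_simp
    rw [h2, ν2, ← neg_div, div_eq_div_iff hpos.ne' h1]
    ring

lemma indep_dual {u v : Fin 3 → E 2} {δ : ℝ} (hδ : 0 < δ) (h1 : ∀ i, ⟪v i, u i⟫ = -δ)
    (h2 : ∀ i j, i ≠ j → ⟪v i, u j⟫ = 0) : LinearIndependent ℝ u := by
  rw [Fintype.linearIndependent_iff]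
  intro a ha i
  have h := congrArg (fun x => ⟪v i, x⟫) ha
  simp only [inner_sum, real_inner_smul_right, inner_zero_right] at h
  rw [Finset.sum_eq_single i (fun j _ hj => by rw [h2 i j hj.symm, mul_zero]) (by simp), h1] at h
  have : a i * δ = 0 := by linarith
  exact (mul_eq_zero.1 this).resolve_right hδ.ne'

lemma sconv_eq_D {u v : Fin 3 → E 2} (nv : ∀ i, ‖v i‖ = 1) {c : ℝ}
    (hc2 : -1 / 2 < c) (hc : ∀ i j, i ≠ j → ⟪v i, v j⟫ = c) (hv : LinearIndependent ℝ v)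
    {δ : ℝ} (hδ : 0 < δ) (h1 : ∀ i, ⟪v i, u i⟫ = -δ)
    (h2 : ∀ i j, i ≠ j → ⟪v i, u j⟫ = 0) : sconv {v 0, v 1, v 2} = Dset u := by
  have hco : ∀ x ∈ Dset u, ∃ a : Fin 3 → ℝ, (∀ i, 0 ≤ a i) ∧
      x = a 0 • v 0 + a 1 • v 1 + a 2 • v 2 := by
    rintro x ⟨-, hx⟩
    obtain ⟨a, rfl⟩ := expand hv x
    refine ⟨a, ?_, rfl⟩
    intro i
    have h := hx i
    have : ⟪a 0 • v 0 + a 1 • v 1 + a 2 • v 2, u i⟫ = -(a i * δ) := by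
      simp only [inner_add_left, real_inner_smul_left]
      fin_cases i
      · rw [Fin.zero_eta, h1 0, h2 1 0 (by decide), h2 2 0 (by decide)]; ring
      · rw [Fin.mk_one, h1 1, h2 0 1 (by decide), h2 2 1 (by decide)]; ring
      · simp only [Fin.reduceFinMk]; rw [h1 2, h2 0 2 (by decide), h2 1 2 (by decide)]; ring
    rw [this] at h
    by_contra! hn
    nlinarith [mul_neg_of_neg_of_pos hn hδ]
  have hvD : ∀ i, v i ∈ Dset u := by
    intro i
    refine ⟨mem_us.2 (nv i), fun j => ?_⟩
    by_cases h : i = j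
    · subst h; rw [h1]; linarith
    · rw [h2 i j h]
  have hVv : ∀ k, ⟪v 0 + v 1 + v 2, v k⟫ = 1 + 2 * c := by
    intro k
    fin_cases k <;>
    simp [inner_add_left, nv, hc 0 1 (by decide),
      hc 0 2 (by decide), hc 1 2 (by decide), hc 1 0 (by decide), hc 2 0 (by decide),
      hc 2 1 (by decide)] <;> ring
  have hVx : ∀ x ∈ Dset u, 0 < ⟪v 0 + v 1 + v 2, x⟫ := by
    intro x hx
    obtain ⟨a, ha, hxa⟩ := hco x hx
    have e : ⟪v 0 + v 1 + v 2, x⟫ = (a 0 + a 1 + a 2) * (1 + 2 * c) := by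
      rw [hxa]; simp only [inner_add_right (v 0 + v 1 + v 2), real_inner_smul_right, hVv]; ring
    rw [e]
    apply mul_pos _ (by linarith)
    rcases (add_nonneg (add_nonneg (ha 0) (ha 1)) (ha 2)).lt_or_eq with h | h
    · exact h
    · exfalso
      have A0 := ha 0
      have A1 := ha 1
      have A2 := ha 2
      have z0 : a 0 = 0 := by linarith
      have z1 : a 1 = 0 := by linarith
      have z2 : a 2 = 0 := by linarith
      rw [z0, z1, z2] at hxa
      have := mem_us.1 hx.1
      rw [hxa] at this
      simp at this
  have hV0 : v 0 + v 1 + v 2 ≠ 0 := by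
    intro h
    have := hVx _ (hvD 0)
    rw [h, inner_zero_left] at this
    exact lt_irrefl _ this
  have hpos := norm_pos_iff.2 hV0
  have hDc : SConvex (Dset u) := by
    refine ⟨fun x hx => hx.1, ⟨‖v 0 + v 1 + v 2‖⁻¹ • (v 0 + v 1 + v 2), ?_, ?_⟩, ?_⟩
    · rw [mem_us, norm_smul, norm_inv, norm_norm, inv_mul_cancel₀ hpos.ne']
    · intro x hx
      rw [real_inner_smul_left]
      exact mul_pos (inv_pos.2 hpos) (hVx x hx)
    · intro x hx y hy z hz
      obtain ⟨a, b, ha, hb, hzz⟩ := comb_of_seg (mem_us.1 hx.1) (mem_us.1 hy.1) (hVx x hx) (hVx y hy) hz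
      refine ⟨hz.1, fun i => ?_⟩
      rw [hzz, inner_add_left, real_inner_smul_left, real_inner_smul_left]
      have := mul_nonneg ha (neg_nonneg.2 (hx.2 i))
      have := mul_nonneg hb (neg_nonneg.2 (hy.2 i))
      linarith
  apply Set.Subset.antisymm
  · apply Set.sInter_subset_of_mem
    refine ⟨hDc, ?_⟩
    rintro x (rfl | rfl | rfl)
    exacts [hvD 0, hvD 1, hvD 2]
  · intro x hx C hC
    obtain ⟨hC, hsub⟩ := hC
    obtain ⟨a, ha, hxa⟩ := hco x hx
    obtain ⟨t, ht, k, hk, e⟩ := cone_add hC (hsub (by simp : v 0 ∈ _)) (hsub (by simp : v 1 ∈ _))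
      (ha 0) (ha 1)
    obtain ⟨t', ht', k', hk', e'⟩ := cone_add hC hk (hsub (by simp : v 2 ∈ _)) ht (ha 2)
    rw [← e, ← hxa] at e'
    have n1 := mem_us.1 hx.1
    rw [e', norm_smul, mem_us.1 (hC.1 hk'), Real.norm_eq_abs, abs_of_nonneg ht', mul_one] at n1
    rw [e', n1, one_smul]
    exact hk'

end SphericalPal
namespace SphericalPal

lemma T_main {T : Set (E 2)} (hT : IsRegularTriangle T) (h0 : 0 < width T)
    (hpi : width T ≤ π / 2) : ∃ s : ℝ, 0 < s ∧ s < 1 ∧ inradius T ≤ Real.arcsin s ∧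
      Real.cos (width T) ≤ kap s ∧ ∃ u : Fin 3 → E 2, (∀ i, ‖u i‖ = 1) ∧
      (∀ i j, i ≠ j → ⟪u i, u j⟫ = (3 * s ^ 2 - 1) / 2) ∧ LinearIndependent ℝ u ∧
      T = Dset u := by
  obtain ⟨v₁, v₂, v₃, hv1, hv2, hv3, hli, e1, e2, hTs⟩ := hT
  have n1 := mem_us.1 hv1
  have n2 := mem_us.1 hv2
  have n3 := mem_us.1 hv3
  have c1 : ⟪v₁, v₂⟫ = ⟪v₂, v₃⟫ := Real.arccos_injOn
    ⟨neg_one_le_inner_us n1 n2, inner_le_one_us n1 n2⟩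
    ⟨neg_one_le_inner_us n2 n3, inner_le_one_us n2 n3⟩ e1
  have c2 : ⟪v₂, v₃⟫ = ⟪v₁, v₃⟫ := Real.arccos_injOn
    ⟨neg_one_le_inner_us n2 n3, inner_le_one_us n2 n3⟩
    ⟨neg_one_le_inner_us n1 n3, inner_le_one_us n1 n3⟩ e2
  obtain ⟨c, hc⟩ : ∃ c, c = ⟪v₁, v₂⟫ := ⟨_, rfl⟩
  set v : Fin 3 → E 2 := ![v₁, v₂, v₃] with hv
  have nv : ∀ i, ‖v i‖ = 1 := by
    intro i; fin_cases i
    exacts [n1, n2, n3]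
  have hcc : ∀ i j, i ≠ j → ⟪v i, v j⟫ = c := by
    have d1 : ⟪v₂, v₁⟫ = c := by rw [real_inner_comm, hc]
    have d2 : ⟪v₃, v₂⟫ = c := by rw [real_inner_comm, hc, c1]
    have d3 : ⟪v₃, v₁⟫ = c := by rw [real_inner_comm, hc, c1, c2]
    intro i j hij
    fin_cases i <;> fin_cases j <;> simp [hv] at hij ⊢
    exacts [hc.symm, by rw [hc, c1, c2], d1, by rw [hc, c1], d3, d2]
  have hc1 : c < 1 := by
    have := inner_le_one_us n1 n2
    rw [← hc] at this
    apply lt_of_le_of_ne this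
    intro h
    have h2 := eq_of_inner_one_us n1 n2 (by rw [← hc, h])
    have : (0 : Fin 3) = 1 := hli.injective (by simpa [hv] using h2)
    exact absurd this (by decide)
  have hc2 : -1 / 2 < c := by
    have hV : v 0 + v 1 + v 2 ≠ 0 := by
      intro h
      have := Fintype.linearIndependent_iff.1 hli (fun _ => 1)
        (by rw [Fin.sum_univ_three]; simpa using h) 0
      exact one_ne_zero this
    have h2 := real_inner_self_pos.2 hV
    simp only [inner_add_left, inner_add_right, inner_self_us (nv _), hcc 0 1 (by decide),
      hcc 0 2 (by decide), hcc 1 2 (by decide), hcc 1 0 (by decide), hcc 2 0 (by decide),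
      hcc 2 1 (by decide)] at h2
    linarith
  obtain ⟨u, δ, g, hδ, hgm, hg1, nu, h1, h2, hg⟩ := dual_exists nv hc1 hc2 hcc
  have hlu := indep_dual hδ h1 h2
  have hTD : T = Dset u := by
    rw [hTs, ← sconv_eq_D nv hc2 hcc hli hδ h1 h2]
    rfl
  have hvT : ∀ i, v i ∈ T := by
    intro i
    rw [hTD]
    refine ⟨mem_us.2 (nv i), fun j => ?_⟩
    by_cases h : i = j
    · subst h; rw [h1]; linarith
    · rw [h2 i j h]
  have hsup : ∀ x, (∀ y ∈ T, ⟪y, x⟫ ≤ 0) → (∃ y ∈ T, ⟪y, x⟫ = 0) →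
      ∃ a : Fin 3 → ℝ, (∀ i, 0 ≤ a i) ∧ (∃ i, a i = 0) ∧
        x = a 0 • u 0 + a 1 • u 1 + a 2 • u 2 := by
    rintro x hx ⟨y, hy, hy0⟩
    obtain ⟨a, rfl⟩ := expand hlu x
    obtain ⟨b, hb⟩ := expand hli y
    have hva : ∀ i, ⟪v i, a 0 • u 0 + a 1 • u 1 + a 2 • u 2⟫ = -(a i * δ) := by
      intro i
      simp only [inner_add_right, real_inner_smul_right]
      fin_cases i
      · rw [Fin.zero_eta, h1 0, h2 0 1 (by decide), h2 0 2 (by decide)]; ring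
      · rw [Fin.mk_one, h1 1, h2 1 0 (by decide), h2 1 2 (by decide)]; ring
      · simp only [Fin.reduceFinMk]; rw [h1 2, h2 2 0 (by decide), h2 2 1 (by decide)]; ring
    have hyb : ∀ i, ⟪y, u i⟫ = -(b i * δ) := by
      intro i
      rw [hb]
      simp only [inner_add_left, real_inner_smul_left]
      fin_cases i
      · rw [Fin.zero_eta, h1 0, h2 1 0 (by decide), h2 2 0 (by decide)]; ring
      · rw [Fin.mk_one, h1 1, h2 0 1 (by decide), h2 2 1 (by decide)]; ring
      · simp only [Fin.reduceFinMk]; rw [h1 2, h2 0 2 (by decide), h2 1 2 (by decide)]; ring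
    have ha : ∀ i, 0 ≤ a i := by
      intro i
      have := hx _ (hvT i)
      rw [hva] at this
      by_contra! hn
      nlinarith [mul_neg_of_neg_of_pos hn hδ]
    have hb0 : ∀ i, 0 ≤ b i := by
      intro i
      rw [hTD] at hy
      have := hy.2 i
      rw [hyb] at this
      by_contra! hn
      nlinarith [mul_neg_of_neg_of_pos hn hδ]
    refine ⟨a, ha, ?_, rfl⟩
    by_contra! hne
    have hap : ∀ i, 0 < a i := fun i => lt_of_le_of_ne (ha i) (hne i).symm
    have hsum : ⟪y, a 0 • u 0 + a 1 • u 1 + a 2 • u 2⟫ =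
        -((a 0 * b 0 + a 1 * b 1 + a 2 * b 2) * δ) := by
      simp only [inner_add_right, real_inner_smul_right, hyb]; ring
    rw [hsum, neg_eq_zero] at hy0
    have hz := (mul_eq_zero.1 hy0).resolve_right hδ.ne'
    have m : ∀ i, 0 ≤ a i * b i := fun i => mul_nonneg (ha i) (hb0 i)
    have m0 := m 0
    have m1 := m 1
    have m2 := m 2
    have z0 : b 0 = 0 := (mul_eq_zero.1 (by linarith : a 0 * b 0 = 0)).resolve_left (hne 0)
    have z1 : b 1 = 0 := (mul_eq_zero.1 (by linarith : a 1 * b 1 = 0)).resolve_left (hne 1)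
    have z2 : b 2 = 0 := (mul_eq_zero.1 (by linarith : a 2 * b 2 = 0)).resolve_left (hne 2)
    rw [hTD] at hy
    have ny := mem_us.1 hy.1
    rw [hb, z0, z1, z2] at ny
    simp at ny
  obtain ⟨hg0, hcw⟩ := T_width nu hg1 hgm hg h0 hpi hsup
  have hs2 : √((1 - 2 * g) / 3) ^ 2 = (1 - 2 * g) / 3 := Real.sq_sqrt (by linarith)
  have hgram : ∀ i j, i ≠ j → ⟪u i, u j⟫ = (3 * √((1 - 2 * g) / 3) ^ 2 - 1) / 2 := by
    intro i j hij
    rw [hg i j hij, hs2]; ring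
  have hs0 : 0 < √((1 - 2 * g) / 3) := Real.sqrt_pos.2 (by linarith)
  have hs1 : √((1 - 2 * g) / 3) < 1 := by
    rw [Real.sqrt_lt' one_pos]; linarith
  refine ⟨√((1 - 2 * g) / 3), hs0, hs1, ?_, ?_, u, nu, hgram, hlu, hTD⟩
  · rw [hTD]; exact inradius_D_le nu hs0 hs1 hgram
  · unfold kap
    rw [hs2]
    convert hcw using 2
    · ring
    · congr 1; ring

lemma congr_D {u u' : Fin 3 → E 2} (hu : LinearIndependent ℝ u) (hu' : LinearIndependent ℝ u')
    (h : ∀ i j, ⟪u i, u j⟫ = ⟪u' i, u' j⟫) : Congruent (Dset u) (Dset u') := by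
  let b := basisOfLinearIndependentOfCardEqFinrank hu (by simp)
  let b' := basisOfLinearIndependentOfCardEqFinrank hu' (by simp)
  let f := b.equiv b' (Equiv.refl _)
  have hf : ∀ i, f (u i) = u' i := by
    intro i
    have := b.equiv_apply i b' (Equiv.refl _)
    simpa [b, b'] using this
  have hin : ∀ x y, ⟪f x, f y⟫ = ⟪x, y⟫ := by
    intro x y
    obtain ⟨a, rfl⟩ := expand hu x
    obtain ⟨c, rfl⟩ := expand hu y
    simp only [map_add, map_smul, hf, inner_add_left, inner_add_right, real_inner_smul_left,
      real_inner_smul_right, h]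
  refine ⟨f.isometryOfInner hin, ?_⟩
  ext x
  constructor
  · rintro ⟨y, hy, rfl⟩
    refine ⟨?_, ?_⟩
    · rw [mem_us, LinearIsometryEquiv.norm_map]; exact mem_us.1 hy.1
    · intro i
      rw [← hf i]
      exact (hin y (u i)).trans_le (hy.2 i)
  · intro hx
    obtain ⟨y, rfl⟩ := (f.isometryOfInner hin).surjective x
    refine ⟨y, ⟨?_, ?_⟩, rfl⟩
    · have := mem_us.1 hx.1
      rw [LinearIsometryEquiv.norm_map] at this
      exact mem_us.2 this
    · intro i
      have := hx.2 i
      rw [← hf i] at this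
      exact (hin y (u i)).symm.trans_le this

lemma Congruent.symm' {A B : Set (E 2)} (h : Congruent A B) : Congruent B A := by
  obtain ⟨f, rfl⟩ := h
  refine ⟨f.symm, ?_⟩
  rw [← Set.image_comp]
  simp

lemma inradius_sub {A B : Set (E 2)} (h : Congruent A B) :
    {r | 0 ≤ r ∧ ∃ p ∈ unitSphere 2, gball p r ⊆ A} ⊆
      {r | 0 ≤ r ∧ ∃ p ∈ unitSphere 2, gball p r ⊆ B} := by
  obtain ⟨f, rfl⟩ := h
  rintro r ⟨hr, p, hp, hs⟩
  refine ⟨hr, f p, ?_, ?_⟩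
  · rw [mem_us, LinearIsometryEquiv.norm_map]; exact mem_us.1 hp
  · intro x hx
    obtain ⟨y, rfl⟩ := f.surjective x
    refine ⟨y, hs ⟨?_, ?_⟩, rfl⟩
    · have := mem_us.1 hx.1
      rw [LinearIsometryEquiv.norm_map] at this
      exact mem_us.2 this
    · have := hx.2
      unfold gdist at this ⊢
      rwa [LinearIsometryEquiv.inner_map_map] at this

lemma inradius_congr {A B : Set (E 2)} (h : Congruent A B) : inradius A = inradius B := by
  unfold inradius
  rw [Set.Subset.antisymm (inradius_sub h) (inradius_sub h.symm')]

end SphericalPal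

/-- the regular triangle minimizes the inradius among spherical convex
bodies of width `0 < w ≤ π/2`, with equality iff congruence. -/
theorem inradius_minimality (w : ℝ) (hw0 : 0 < w) (hw : w ≤ π / 2)
    (K T : Set (E 2)) (hK : IsConvexBody K) (hKw : width K = w)
    (hT : IsRegularTriangle T) (hTw : width T = w) :
    inradius T ≤ inradius K ∧ (inradius T = inradius K ↔ Congruent K T) := by

  subst hKw
  obtain ⟨s, hs0, hs1, hsr, hsk, hseq⟩ := K_main hK hw0
  obtain ⟨t, ht0, ht1, htr, htk, u', nu', hg', hl', hT'⟩ :=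
    T_main hT (by rw [hTw]; exact hw0) (by rw [hTw]; exact hw)
  rw [hTw] at htk
  have hts : t ≤ s := by
    by_contra! hlt
    have := kap_lt hs0.le hlt
    linarith
  have har := Real.monotone_arcsin hts
  refine ⟨htr.trans (har.trans hsr), ?_, fun h => (inradius_congr h).symm⟩
  intro heq
  have hst : s = t := by
    apply Real.injOn_arcsin ⟨by linarith, hs1.le⟩ ⟨by linarith, ht1.le⟩
    linarith
  subst hst
  obtain ⟨u, nu, hg, hl, hKu⟩ := hseq (by linarith)
  rw [hKu, hT']
  apply congr_D hl hl'
  intro i j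
  by_cases hij : i = j
  · subst hij; rw [inner_self_us (nu i), inner_self_us (nu' i)]
  · rw [hg i j hij, hg' i j hij]
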